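/- **Conventions.** A *PO system* is a set $P$ with a transitive antisymmetric relation $<$; write $p\le q$ for "$p<q$ or $p=q$", and $P^d=\{p\in P: p\not<p\}$. An *ideal* of $P$ is a nonempty lower subset $J$ such that any two elements of $J$ have an upper bound in $J$; $p_\downarrow=\{q: q\le p\}$. The *ideal completion* $\mathrm{id}(P)$ is the set of ideals of $P$ with the relation: $J<K$ iff either $J\subsetneq K$, or $J=K$ and $J$ is not of the form $p_\downarrow$ with $p\in P^d$. An *$\omega$-Stone space* is a second countable, locally compact, Hausdorff, totally disconnected space $W$. $S'$ denotes the derived set of $S\subseteq W$. For $A\subseteq W$ compact open, $(A)$ is the Boolean ring of compact open subsets of $A$. A **nonempty** compact open $A$ is *PI* if for every compact open $B\subseteq A$ either $(B)\cong(A)$ or $(A\setminus B)\cong(A)$. $W$ is *primitive* if every compact open subset of $W$ is a disjoint union of finitely many (possibly zero) PI sets. For a PO system $P$, a *$P$-partition* of $W$ is a family $\mathscr X=\{X_p\}_{p\in P}$ of nonempty pairwise disjoint subsets, with union $X\subseteq W$, such that $X_p'\cap X=\bigcup_{q<p}X_q$ for all $p$. Put $T_{\mathscr X}(A)=\{p: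 A\cap X_p\neq\emptyset\}$. A compact open $A$ is *$p$-trim* if $T_{\mathscr X}(A)=\{q: q\ge p\}$ and, when $p\in P^d$, $|A\cap X_p|=1$; it is *trim* if it is $p$-trim for some $p$. The $P$-partition is *trim* if (T1) every point of $W$ has a neighbourhood base of trim sets; (T2) whenever a $p$-trim set exists, every point with a neighbourhood base of $p$-trim sets lies in $X_p$; (T3) every point of $X_p$ has a $p$-trim neighbourhood, for each $p$. For $w\in W$ let $I_w=\{p: w \text{ lies in some } p\text{-trim set}\}$; the *ideal completion* of a trim $P$-partition $\mathscr X$ is the family $\mathrm{id}(\mathscr X)=\{Y(J)\}_{J\in\mathrm{id}(P)}$, $Y(J)=\{w\in W: I_w=J\}$. A $P$-partition $\mathscr Z$ *regularly consolidates* a $Q$-partition $\mathscr Y$ if both satisfy (T1) and there is a map $\alpha:Q\to P$ with $Y_q\subseteq Z_{\alpha(q)}$ for all $q\in Q$, such that $p\in\alpha(T_{\mathscr Y}(A))$ for every $p\in P$ and every set $A$ that is $p$-trim for $\mathscr Z$. The *structure diagram* $\mathscr S(W)$ is the PO system of isomorphism classes $[A]$ of the rings $(A)$, $A$ a PI subset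 of $W$, with $[A]<[B]$ iff $(A)\times(B)\cong(A)$. The *canonical partition* is $\mathscr X(W)=\{X_p\}_{p\in\mathscr S(W)}$, where $X_p$ is the set of points with a neighbourhood base of PI sets of class $p$. The *orbit diagram* $\mathscr O(W)$ is the set of orbits of points of $W$ under the group of homeomorphisms of $W$, with $O<O'$ iff some point of $O$ lies in the derived set of $O'$; as a family of subsets of $W$ it is indexed by itself. **Theorem.** Let $W$ be a primitive $\omega$-Stone space. Then $\mathscr X(W)$ is a trim $\mathscr S(W)$-partition of $W$, and its ideal completion $\mathrm{id}(\mathscr X(W))=\{Y(J)\}$ equals the orbit diagram $\mathscr O(W)$: the map $J\mapsto Y(J)$ is a bijection from $\mathrm{id}(\mathscr S(W))$ onto the set of orbits of $W$, and $J<K$ if and only if $Y(J)<Y(K)$ in $\mathscr O(W)$; in particular $\mathscr O(W)$ is a PO system. Moreover, for every PO system $Q$ and every trim $Q$-partition $\mathscr Y$ of $W$, $\mathscr O(W)$ regularly consolidates the $\mathrm{id}(Q)$-partition $\mathrm{id}(\mathscr Y)$. -/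

import Mathlib

universe u v

/-- A PO system: a set with a transitive antisymmetric relation `<`. -/
structure POSystem (P : Type u) : Type u where
  lt : P → P → Prop
  lt_trans : ∀ {a b c}, lt a b → lt b c → lt a c
  lt_antisymm : ∀ {a b}, lt a b → lt b a → a = b

namespace POSystem

variable {P : Type*}

/-- `a ≤ b` iff `a < b` or `a = b`. -/
def le (S : POSystem P) (a b : P) : Prop := S.lt a b ∨ a = b

/-- An ideal of a PO system: a (nonempty) directed lower subset. -/
def IsIdeal (S : POSystem P) (J : Set P) : Prop :=
  J.Nonempty ∧ (∀ x ∈ J, ∀ y : P, S.le y x → y ∈ J) ∧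
    ∀ x ∈ J, ∀ y ∈ J, ∃ z ∈ J, S.le x z ∧ S.le y z

/-- The underlying set of the ideal completion `id(P)`. -/
def Idl (S : POSystem P) : Type _ := {J : Set P // IsIdeal S J}

/-- The principal ideal `p↓`. -/
def principalIdeal (S : POSystem P) (p : P) : Set P := {q | S.le q p}

/-- The order relation on the ideal completion `id(P)`: ordered by inclusion, with
`id(P)^d` consisting of the principal ideals `p↓` for `p ∈ P^d`. -/
def idLt (S : POSystem P) (J K : Idl S) : Prop :=
  (J.1 ⊆ K.1 ∧ J ≠ K) ∨ (J = K ∧ ¬ ∃ p : P, ¬ S.lt p p ∧ J.1 = principalIdeal S p)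

/-- The ideal completion `id(P)` of a PO system. -/
def idPO (S : POSystem P) : POSystem (Idl S) where
  lt := idLt S
  lt_trans := by
    intro a b c h1 h2
    unfold idLt at h1 h2 ⊢
    rcases h1 with ⟨hab, hne⟩ | ⟨heq, h⟩
    · rcases h2 with ⟨hbc, hne'⟩ | ⟨heq', h'⟩
      · refine Or.inl ⟨hab.trans hbc, fun hac => hne ?_⟩
        exact Subtype.ext (subset_antisymm hab (by rw [hac]; exact hbc))
      · rw [← heq']; exact Or.inl ⟨hab, hne⟩
    · rw [heq]; exact h2
  lt_antisymm := by
    intro a b h1 h2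
    unfold idLt at h1 h2
    rcases h1 with ⟨hab, _⟩ | ⟨heq, _⟩
    · rcases h2 with ⟨hba, _⟩ | ⟨heq, _⟩
      · exact Subtype.ext (subset_antisymm hab hba)
      · exact heq.symm
    · exact heq

end POSystem

open POSystem

section Partitions

variable {W : Type*} [TopologicalSpace W] {P : Type*} {Q : Type*}

/-- The type `T(A)` of a subset `A` with respect to a partition `X`. -/
def ptype (X : P → Set W) (A : Set W) : Set P := {p | (A ∩ X p).Nonempty}

/-- A `P`-partition of `W`: pairwise disjoint nonempty sets `X p` such that
`(X p)' ∩ X = ⋃_{q < p} X q`, where `X = ⋃_p X p` need not be all of `W`. -/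
def IsPPartition (S : POSystem P) (X : P → Set W) : Prop :=
  (∀ p, (X p).Nonempty) ∧ (Pairwise fun p q => Disjoint (X p) (X q)) ∧
    ∀ p, derivedSet (X p) ∩ (⋃ q, X q) = ⋃ q ∈ {q : P | S.lt q p}, X q

/-- `A` is a `p`-trim set. -/
def IsTrimAt (S : POSystem P) (X : P → Set W) (A : Set W) (p : P) : Prop :=
  IsCompact A ∧ IsOpen A ∧ ptype X A = {q | S.le p q} ∧
    (¬ S.lt p p → ∃! x, x ∈ A ∩ X p)

/-- `A` is a trim set. -/
def IsTrimSet (S : POSystem P) (X : P → Set W) (A : Set W) : Prop :=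
  ∃ p, IsTrimAt S X A p

/-- `P̂`: the set of `p` for which some `p`-trim set exists. -/
def Phat (S : POSystem P) (X : P → Set W) : Set P := {p | ∃ A, IsTrimAt S X A p}

/-- Axiom T1: every point has a neighbourhood base of trim sets. -/
def HasTrimBases (S : POSystem P) (X : P → Set W) : Prop :=
  ∀ w : W, ∀ U ∈ nhds w, ∃ A, IsTrimSet S X A ∧ w ∈ A ∧ A ⊆ U

/-- Axiom T2 (fullness). -/
def IsFull (S : POSystem P) (X : P → Set W) : Prop :=
  ∀ p ∈ Phat S X, ∀ w : W,
    (∀ U ∈ nhds w, ∃ A, IsTrimAt S X A p ∧ w ∈ A ∧ A ⊆ U) → w ∈ X p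

/-- Axiom T3: all points of `X` are clean. -/
def AllClean (S : POSystem P) (X : P → Set W) : Prop :=
  ∀ p : P, ∀ w ∈ X p, ∃ A, IsTrimAt S X A p ∧ w ∈ A

/-- A trim `P`-partition. -/
def IsTrimPartition (S : POSystem P) (X : P → Set W) : Prop :=
  IsPPartition S X ∧ HasTrimBases S X ∧ IsFull S X ∧ AllClean S X

/-- `I_w`: the set of types of trim neighbourhoods of `w`. -/
def Iw (S : POSystem P) (X : P → Set W) (w : W) : Set P :=
  {p | ∃ A : Set W, IsTrimAt S X A p ∧ w ∈ A}

/-- The blocks `Y(J) = {w | I_w = J}` of the ideal completion of a partition. -/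
def idBlock (S : POSystem P) (X : P → Set W) (J : Idl S) : Set W := {w | Iw S X w = J.1}

/-- The `P`-partition `Z` regularly consolidates the `Q`-partition `Y` via `α : Q → P`:
both satisfy T1, `Y` refines `Z` via `α`, and `p ∈ α(T_Y(A))` for each set `A` that is
`p`-trim with respect to `Z`. -/
def RegConsolidates (SQ : POSystem Q) (SP : POSystem P) (Y : Q → Set W) (Z : P → Set W)
    (α : Q → P) : Prop :=
  IsPPartition SQ Y ∧ IsPPartition SP Z ∧ HasTrimBases SQ Y ∧ HasTrimBases SP Z ∧
    (∀ q, Y q ⊆ Z (α q)) ∧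
    ∀ p ∈ Phat SP Z, ∀ A : Set W, IsTrimAt SP Z A p → p ∈ α '' ptype Y A

end Partitions

section Primitive

variable {W : Type*} [TopologicalSpace W]

/-- The ideal `(A)` of compact open subsets of `A`. -/
def coIdeal (A : Set W) : Set (Set W) := {C | IsCompact C ∧ IsOpen C ∧ C ⊆ A}

/-- `(A) ≅ (B)` as Boolean rings, i.e. as posets under inclusion. -/
def IdealIso (A B : Set W) : Prop := Nonempty (↥(coIdeal A) ≃o ↥(coIdeal B))

/-- `(A) × (B) ≅ (A)`. -/
def ProdIdealIso (A B : Set W) : Prop :=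
  Nonempty ((↥(coIdeal A) × ↥(coIdeal B)) ≃o ↥(coIdeal A))

/-- A nonempty compact open set `A` is pseudo-indecomposable (PI) if for each compact open
`B ⊆ A` either `(B) ≅ (A)` or `(A - B) ≅ (A)`. -/
def IsPISet (A : Set W) : Prop :=
  A.Nonempty ∧ IsCompact A ∧ IsOpen A ∧ ∀ B : Set W, IsCompact B → IsOpen B → B ⊆ A →
    IdealIso B A ∨ IdealIso (A \ B) A

/-- `W` is primitive: every compact open set is a finite disjoint union of PI sets
(the empty set being the empty union). -/
def PrimitiveSpace (W : Type*) [TopologicalSpace W] : Prop :=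
  ∀ A : Set W, IsCompact A → IsOpen A →
    ∃ (n : ℕ) (F : Fin n → Set W), (∀ i, IsPISet (F i)) ∧
      (Pairwise fun i j => Disjoint (F i) (F j)) ∧ A = ⋃ i, F i

/-- The setoid of PI compact opens up to isomorphism of their ideals. -/
def piIsoSetoid (W : Type*) [TopologicalSpace W] : Setoid {A : Set W // IsPISet A} where
  r A B := IdealIso A.1 B.1
  iseqv := ⟨fun _ => ⟨OrderIso.refl _⟩,
    fun h => h.elim fun e => ⟨e.symm⟩,
    fun h1 h2 => h1.elim fun e => h2.elim fun f => ⟨e.trans f⟩⟩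

/-- The underlying set of the structure diagram `𝒮(W)`: isomorphism classes of
PI compact open subsets of `W`. -/
def SDiagram (W : Type*) [TopologicalSpace W] : Type _ := Quotient (piIsoSetoid W)

/-- The relation on `𝒮(W)`: `[A] < [B]` iff `(A) × (B) ≅ (A)`. -/
def SDiagramLt (x y : SDiagram W) : Prop :=
  ∃ A B : {A : Set W // IsPISet A}, x = Quotient.mk (piIsoSetoid W) A ∧
    y = Quotient.mk (piIsoSetoid W) B ∧ ProdIdealIso A.1 B.1

/-- The product of two order isomorphisms. -/
def prodOrderIso {α β γ δ : Type*} [LE α] [LE β] [LE γ] [LE δ] (e : α ≃o γ) (f : β ≃o δ) :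
    α × β ≃o γ × δ where
  toEquiv := e.toEquiv.prodCongr f.toEquiv
  map_rel_iff' := by
    intro a b
    exact and_congr e.map_rel_iff f.map_rel_iff

/-- The structure diagram `𝒮(W)` as a PO system. -/
def SDiagramPO (W : Type*) [TopologicalSpace W] : POSystem (SDiagram W) where
  lt := SDiagramLt
  lt_trans := by
    rintro _ _ _ ⟨A, B, rfl, rfl, ⟨e⟩⟩ ⟨B', C, h, rfl, ⟨f⟩⟩
    obtain ⟨g⟩ : IdealIso B.1 B'.1 := Quotient.exact h
    refine ⟨A, C, rfl, rfl, ⟨?_⟩⟩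
    have f' : (↥(coIdeal B.1) × ↥(coIdeal C.1)) ≃o ↥(coIdeal B.1) :=
      (prodOrderIso g (OrderIso.refl _)).trans (f.trans g.symm)
    exact ((prodOrderIso e.symm (OrderIso.refl _)).trans
      ((OrderIso.prodAssoc _ _ _).trans (prodOrderIso (OrderIso.refl _) f'))).trans e
  lt_antisymm := by
    rintro _ _ ⟨A, B, rfl, rfl, ⟨e⟩⟩ ⟨B', A', hB, hA, ⟨f⟩⟩
    obtain ⟨g⟩ : IdealIso B.1 B'.1 := Quotient.exact hB
    obtain ⟨k⟩ : IdealIso A.1 A'.1 := Quotient.exact hA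
    exact Quotient.sound ⟨e.symm.trans (OrderIso.prodComm.trans
      ((prodOrderIso g k).trans (f.trans g.symm)))⟩

/-- The blocks of the canonical partition `𝒳(W)`: points having a neighbourhood base
of compact open sets of class `p`. -/
def canonicalBlock (p : SDiagram W) : Set W :=
  {w | ∀ U ∈ nhds w, ∃ A : {A : Set W // IsPISet A},
      Quotient.mk (piIsoSetoid W) A = p ∧ w ∈ A.1 ∧ A.1 ⊆ U}

/-- The orbit `[w]` of a point under the group of homeomorphisms of `W`. -/
def homeoOrbit (w : W) : Set W := {x | ∃ h : W ≃ₜ W, h w = x}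

/-- The underlying set of the orbit diagram `𝒪(W)`: the set of orbits of points of `W`. -/
def Orbits (W : Type*) [TopologicalSpace W] : Type _ := {O : Set W // ∃ w, O = homeoOrbit w}

/-- The relation on `𝒪(W)`: `O < O'` iff some point of `O` is a limit point of `O'`. -/
def OrbitLt (O O' : Orbits W) : Prop := ∃ w ∈ O.1, w ∈ derivedSet O'.1

end Primitive

open Topology

set_option linter.unusedSectionVars false

/-! ### PO systems -/

namespace POSystem

variable {P : Type*} (S : POSystem P)

protected theorem le_rfl {a : P} : S.le a a := Or.inr rfl

protected theorem le_trans {a b c : P} (h₁ : S.le a b) (h₂ : S.le b c) : S.le a c := by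
  rcases h₁ with h₁ | rfl
  · rcases h₂ with h₂ | rfl
    · exact Or.inl (S.lt_trans h₁ h₂)
    · exact Or.inl h₁
  · exact h₂

protected theorem le_antisymm {a b : P} (h₁ : S.le a b) (h₂ : S.le b a) : a = b := by
  rcases h₁ with h₁ | rfl
  · rcases h₂ with h₂ | rfl
    · exact S.lt_antisymm h₁ h₂
    · rfl
  · rfl

theorem lt_self_of_lt_of_le {a b : P} (h₁ : S.lt a b) (h₂ : S.le b a) : S.lt a a := by
  rcases h₂ with h₂ | rfl
  · exact S.lt_trans h₁ h₂
  · exact h₁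

theorem isIdeal_principalIdeal (p : P) : S.IsIdeal (S.principalIdeal p) :=
  ⟨⟨p, S.le_rfl⟩, fun _ hx _ hy => S.le_trans hy hx, fun _ hx _ hy => ⟨p, S.le_rfl, hx, hy⟩⟩

theorem principalIdeal_injective {p q : P} (h : S.principalIdeal p = S.principalIdeal q) :
    p = q :=
  S.le_antisymm (h ▸ S.le_rfl : p ∈ S.principalIdeal q) (h ▸ S.le_rfl : q ∈ S.principalIdeal p)

end POSystem

/-! ### Compact open sets -/

section CompactOpen

variable {W : Type*} [TopologicalSpace W]

/-- `A` is compact and open. -/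
def IsCompactOpen (A : Set W) : Prop := IsCompact A ∧ IsOpen A

namespace IsCompactOpen

theorem empty : IsCompactOpen (∅ : Set W) := ⟨isCompact_empty, isOpen_empty⟩

theorem union {A B : Set W} (hA : IsCompactOpen A) (hB : IsCompactOpen B) :
    IsCompactOpen (A ∪ B) := ⟨hA.1.union hB.1, hA.2.union hB.2⟩

variable [T2Space W]

theorem isClosed {A : Set W} (hA : IsCompactOpen A) : IsClosed A := hA.1.isClosed

theorem inter {A B : Set W} (hA : IsCompactOpen A) (hB : IsCompactOpen B) :
    IsCompactOpen (A ∩ B) := ⟨hA.1.inter_right hB.isClosed, hA.2.inter hB.2⟩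

theorem diff {A B : Set W} (hA : IsCompactOpen A) (hB : IsCompactOpen B) :
    IsCompactOpen (A \ B) := ⟨hA.1.diff hB.2, hA.2.sdiff hB.isClosed⟩

end IsCompactOpen

variable [T2Space W] [LocallyCompactSpace W] [TotallyDisconnectedSpace W]

theorem exists_isCompactOpen_subset {w : W} {N : Set W} (hN : N ∈ 𝓝 w) :
    ∃ C, IsCompactOpen C ∧ w ∈ C ∧ C ⊆ N := by
  obtain ⟨K, hK, hKN, hKc⟩ := local_compact_nhds hN
  obtain ⟨C, hC, hwC, hCK⟩ :=
    (loc_compact_Haus_tot_disc_of_zero_dim (H := W)).mem_nhds_iff.1 hK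
  exact ⟨C, ⟨hKc.of_isClosed_subset hC.1 hCK, hC.2⟩, hwC, hCK.trans hKN⟩

theorem exists_seq_isCompactOpen [SecondCountableTopology W] :
    ∃ C : ℕ → Set W, (∀ n, IsCompactOpen (C n)) ∧
      ∀ w : W, ∀ N ∈ 𝓝 w, ∃ n, w ∈ C n ∧ C n ⊆ N := by
  classical
  obtain ⟨b, hbc, -, hb⟩ := TopologicalSpace.exists_countable_basis W
  have hcount : Countable (b × b) := by
    have := hbc.to_subtype
    infer_instance
  let D : b × b → Set W := fun p =>
    if h : ∃ C, IsCompactOpen C ∧ p.1.1 ⊆ C ∧ C ⊆ p.2.1 then h.choose else ∅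
  have hD : ∀ p, IsCompactOpen (D p) := by
    intro p
    by_cases h : ∃ C, IsCompactOpen C ∧ p.1.1 ⊆ C ∧ C ⊆ p.2.1
    · simp only [D, dif_pos h]; exact h.choose_spec.1
    · simp only [D, dif_neg h]; exact IsCompactOpen.empty
  have hDb : ∀ w : W, ∀ N ∈ 𝓝 w, ∃ p, w ∈ D p ∧ D p ⊆ N := by
    intro w N hN
    obtain ⟨V, hV, hwV, hVN⟩ := hb.mem_nhds_iff.1 hN
    obtain ⟨C, hC, hwC, hCV⟩ := exists_isCompactOpen_subset ((hb.isOpen hV).mem_nhds hwV)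
    obtain ⟨U, hU, hwU, hUC⟩ := hb.mem_nhds_iff.1 (hC.2.mem_nhds hwC)
    have h : ∃ C, IsCompactOpen C ∧ U ⊆ C ∧ C ⊆ V := ⟨C, hC, hUC, hCV⟩
    refine ⟨(⟨U, hU⟩, ⟨V, hV⟩), ?_⟩
    simp only [D, dif_pos h]
    exact ⟨h.choose_spec.2.1 hwU, h.choose_spec.2.2.trans hVN⟩
  obtain hE | hE := isEmpty_or_nonempty (b × b)
  · refine ⟨fun _ => ∅, fun _ => IsCompactOpen.empty, fun w N hN => ?_⟩
    obtain ⟨p, -⟩ := hDb w N hN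
    exact (hE.false p).elim
  · obtain ⟨f, hf⟩ := exists_surjective_nat (b × b)
    refine ⟨D ∘ f, fun n => hD _, fun w N hN => ?_⟩
    obtain ⟨p, hp⟩ := hDb w N hN
    obtain ⟨n, rfl⟩ := hf p
    exact ⟨n, hp⟩

end CompactOpen

/-! ### The back-and-forth theorem of Vaught -/

section BackForth

variable {W : Type*} [TopologicalSpace W]

/-- A relation between compact open sets with the back-and-forth property. -/
structure BackForth (R : Set W → Set W → Prop) : Prop where
  left : ∀ {U V}, R U V → IsCompactOpen U
  right : ∀ {U V}, R U V → IsCompactOpen V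
  nonempty_iff : ∀ {U V}, R U V → (U.Nonempty ↔ V.Nonempty)
  forth : ∀ {U V}, R U V → ∀ U₁ ⊆ U, IsCompactOpen U₁ →
    ∃ V₁ ⊆ V, R U₁ V₁ ∧ R (U \ U₁) (V \ V₁)
  back : ∀ {U V}, R U V → ∀ V₁ ⊆ V, IsCompactOpen V₁ →
    ∃ U₁ ⊆ U, R U₁ V₁ ∧ R (U \ U₁) (V \ V₁)

theorem BackForth.swap {R : Set W → Set W → Prop} (h : BackForth R) : BackForth (flip R) where
  left := h.right
  right := h.left
  nonempty_iff := fun hr => (h.nonempty_iff hr).symm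
  forth := h.back
  back := h.forth

/-- A family of `R`-related pairs forming simultaneously partitions of `A` and of `B`. -/
structure PairPartition (R : Set W → Set W → Prop) (A B : Set W) (L : Set (Set W × Set W)) :
    Prop where
  rel : ∀ p ∈ L, R p.1 p.2
  subset_left : ∀ p ∈ L, p.1 ⊆ A
  subset_right : ∀ p ∈ L, p.2 ⊆ B
  cover_left : ∀ a ∈ A, ∃ p ∈ L, a ∈ p.1
  cover_right : ∀ b ∈ B, ∃ p ∈ L, b ∈ p.2
  unique_left : ∀ p ∈ L, ∀ q ∈ L, ∀ a, a ∈ p.1 → a ∈ q.1 → p = q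
  unique_right : ∀ p ∈ L, ∀ q ∈ L, ∀ b, b ∈ p.2 → b ∈ q.2 → p = q

/-- Every pair of the first family lies below a pair of the second. -/
def PairRefines (L' L : Set (Set W × Set W)) : Prop :=
  ∀ p ∈ L', ∃ q ∈ L, p.1 ⊆ q.1 ∧ p.2 ⊆ q.2

theorem PairPartition.swap {R : Set W → Set W → Prop} {A B : Set W} {L : Set (Set W × Set W)}
    (h : PairPartition R A B L) : PairPartition (flip R) B A (Prod.swap ⁻¹' L) where
  rel p hp := h.rel _ hp
  subset_left p hp := h.subset_right _ hp
  subset_right p hp := h.subset_left _ hp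
  cover_left b hb := let ⟨p, hp, hbp⟩ := h.cover_right b hb; ⟨p.swap, by simpa using hp, hbp⟩
  cover_right a ha := let ⟨p, hp, hap⟩ := h.cover_left a ha; ⟨p.swap, by simpa using hp, hap⟩
  unique_left p hp q hq b hb hb' :=
    Prod.swap_injective (h.unique_right _ hp _ hq b hb hb')
  unique_right p hp q hq b hb hb' :=
    Prod.swap_injective (h.unique_left _ hp _ hq b hb hb')

variable [T2Space W]

theorem PairPartition.exists_refine_left {R : Set W → Set W → Prop} (hR : BackForth R)
    {A B : Set W} {L : Set (Set W × Set W)} (h : PairPartition R A B L) {C : Set W}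
    (hC : IsCompactOpen C) :
    ∃ L', PairPartition R A B L' ∧ PairRefines L' L ∧ ∀ p ∈ L', p.1 ⊆ C ∨ Disjoint p.1 C := by
  have key : ∀ q : L, ∃ V ⊆ q.1.2, R (q.1.1 ∩ C) V ∧ R (q.1.1 \ C) (q.1.2 \ V) := by
    intro q
    obtain ⟨V, hV, h1, h2⟩ := hR.forth (h.rel _ q.2) (q.1.1 ∩ C) Set.inter_subset_left
      ((hR.left (h.rel _ q.2)).inter hC)
    refine ⟨V, hV, h1, ?_⟩
    have e : q.1.1 \ C = q.1.1 \ (q.1.1 ∩ C) := by ext z; simp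
    rwa [e]
  choose f hfs hf1 hf2 using key
  refine ⟨{p | ∃ q : L, p = (q.1.1 ∩ C, f q) ∨ p = (q.1.1 \ C, q.1.2 \ f q)},
    ⟨?_, ?_, ?_, ?_, ?_, ?_, ?_⟩, ?_, ?_⟩
  · rintro p ⟨q, rfl | rfl⟩
    exacts [hf1 q, hf2 q]
  · rintro p ⟨q, rfl | rfl⟩
    exacts [fun z hz => h.subset_left _ q.2 hz.1, fun z hz => h.subset_left _ q.2 hz.1]
  · rintro p ⟨q, rfl | rfl⟩
    exacts [fun z hz => h.subset_right _ q.2 (hfs q hz), fun z hz => h.subset_right _ q.2 hz.1]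
  · intro a ha
    obtain ⟨q, hq, haq⟩ := h.cover_left a ha
    by_cases haC : a ∈ C
    · exact ⟨_, ⟨⟨q, hq⟩, Or.inl rfl⟩, haq, haC⟩
    · exact ⟨_, ⟨⟨q, hq⟩, Or.inr rfl⟩, haq, haC⟩
  · intro b hb
    obtain ⟨q, hq, hbq⟩ := h.cover_right b hb
    by_cases hbf : b ∈ f ⟨q, hq⟩
    · exact ⟨_, ⟨⟨q, hq⟩, Or.inl rfl⟩, hbf⟩
    · exact ⟨_, ⟨⟨q, hq⟩, Or.inr rfl⟩, hbq, hbf⟩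
  · rintro p ⟨q, hp⟩ p' ⟨q', hp'⟩ a ha ha'
    have hq : q = q' := by
      refine Subtype.ext (h.unique_left _ q.2 _ q'.2 a ?_ ?_)
      · rcases hp with rfl | rfl <;> exact ha.1
      · rcases hp' with rfl | rfl <;> exact ha'.1
    subst hq
    rcases hp with rfl | rfl <;> rcases hp' with rfl | rfl
    exacts [rfl, (ha'.2 ha.2).elim, (ha.2 ha'.2).elim, rfl]
  · rintro p ⟨q, hp⟩ p' ⟨q', hp'⟩ b hb hb'
    have hq : q = q' := by
      refine Subtype.ext (h.unique_right _ q.2 _ q'.2 b ?_ ?_)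
      · rcases hp with rfl | rfl
        exacts [hfs _ hb, hb.1]
      · rcases hp' with rfl | rfl
        exacts [hfs _ hb', hb'.1]
    subst hq
    rcases hp with rfl | rfl <;> rcases hp' with rfl | rfl
    exacts [rfl, (hb'.2 hb).elim, (hb.2 hb').elim, rfl]
  · rintro p ⟨q, rfl | rfl⟩
    exacts [⟨q, q.2, Set.inter_subset_left, hfs q⟩, ⟨q, q.2, Set.sdiff_subset, Set.sdiff_subset⟩]
  · rintro p ⟨q, rfl | rfl⟩
    exacts [Or.inl Set.inter_subset_right, Or.inr Set.disjoint_sdiff_left]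

theorem PairPartition.exists_refine {R : Set W → Set W → Prop} (hR : BackForth R)
    {A B : Set W} {L : Set (Set W × Set W)} (h : PairPartition R A B L) {C : Set W}
    (hC : IsCompactOpen C) :
    ∃ L', PairPartition R A B L' ∧ PairRefines L' L ∧
      (∀ p ∈ L', p.1 ⊆ C ∨ Disjoint p.1 C) ∧ ∀ p ∈ L', p.2 ⊆ C ∨ Disjoint p.2 C := by
  obtain ⟨L₁, h₁, hr₁, hd₁⟩ := h.exists_refine_left hR hC
  obtain ⟨L₂, h₂, hr₂, hd₂⟩ := h₁.swap.exists_refine_left hR.swap hC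
  refine ⟨Prod.swap ⁻¹' L₂, h₂.swap, ?_, ?_, fun p hp => hd₂ _ hp⟩
  · intro p hp
    obtain ⟨q, hq, hq1, hq2⟩ := hr₂ _ hp
    obtain ⟨s, hs, hs1, hs2⟩ := hr₁ _ hq
    exact ⟨s, hs, Set.Subset.trans hq2 hs1, Set.Subset.trans hq1 hs2⟩
  · intro p hp
    obtain ⟨q, hq, hq1, hq2⟩ := hr₂ _ hp
    rcases hd₁ _ hq with h' | h'
    · exact Or.inl (Set.Subset.trans hq2 h')
    · exact Or.inr (h'.mono_left hq2)

/-- A refining sequence of partitions of `A` and `B` into related pairs which separates points. -/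
structure PairSystem (R : Set W → Set W → Prop) (A B : Set W) (L : ℕ → Set (Set W × Set W)) :
    Prop where
  part : ∀ n, PairPartition R A B (L n)
  refines : ∀ n, PairRefines (L (n + 1)) (L n)
  small_left : ∀ a, ∀ N ∈ 𝓝 a, ∃ n, ∀ p ∈ L n, a ∈ p.1 → p.1 ⊆ N
  small_right : ∀ b, ∀ N ∈ 𝓝 b, ∃ n, ∀ p ∈ L n, b ∈ p.2 → p.2 ⊆ N

theorem exists_pairSystem [LocallyCompactSpace W] [TotallyDisconnectedSpace W]
    [SecondCountableTopology W] {R : Set W → Set W → Prop} (hR : BackForth R) {A B : Set W}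
    (hAB : R A B) : ∃ L, PairSystem R A B L := by
  obtain ⟨C, hC, hCb⟩ := exists_seq_isCompactOpen (W := W)
  have h0 : PairPartition R A B {(A, B)} := by
    constructor <;> simp +contextual [hAB]
  choose! next hn1 hn2 hn3 hn4 using
    fun (L : Set (Set W × Set W)) (n : ℕ) (h : PairPartition R A B L) =>
      h.exists_refine hR (hC n)
  let L : ℕ → Set (Set W × Set W) := fun n => Nat.rec {(A, B)} (fun k M => next M k) n
  have hL : ∀ n, PairPartition R A B (L n) := by
    intro n
    induction n with
    | zero => exact h0
    | succ n ih => exact hn1 _ n ih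
  refine ⟨L, hL, fun n => hn2 _ n (hL n), ?_, ?_⟩
  · intro a N hN
    obtain ⟨k, hak, hkN⟩ := hCb a N hN
    refine ⟨k + 1, fun p hp hap => ?_⟩
    rcases hn3 _ k (hL k) p hp with h | h
    · exact h.trans hkN
    · exact (Set.disjoint_left.1 h hap hak).elim
  · intro a N hN
    obtain ⟨k, hak, hkN⟩ := hCb a N hN
    refine ⟨k + 1, fun p hp hap => ?_⟩
    rcases hn4 _ k (hL k) p hp with h | h
    · exact h.trans hkN
    · exact (Set.disjoint_left.1 h hap hak).elim

namespace PairSystem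

variable {R : Set W → Set W → Prop} {A B : Set W} {L : ℕ → Set (Set W × Set W)}

theorem swap (h : PairSystem R A B L) :
    PairSystem (flip R) B A (fun n => Prod.swap ⁻¹' L n) where
  part n := (h.part n).swap
  refines n p hp := by
    obtain ⟨q, hq, h1, h2⟩ := h.refines n _ hp
    exact ⟨q.swap, by simpa using hq, h2, h1⟩
  small_left b N hN := by
    obtain ⟨n, hn⟩ := h.small_right b N hN
    exact ⟨n, fun p hp hb => hn _ hp hb⟩
  small_right b N hN := by
    obtain ⟨n, hn⟩ := h.small_left b N hN
    exact ⟨n, fun p hp hb => hn _ hp hb⟩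

/-- Points of `A` and `B` that are matched at every stage. -/
def Matched (L : ℕ → Set (Set W × Set W)) (a b : W) : Prop := ∀ n, ∃ p ∈ L n, a ∈ p.1 ∧ b ∈ p.2

theorem matched_swap {a b : W} :
    Matched (fun n => Prod.swap ⁻¹' L n) b a ↔ Matched L a b := by
  constructor
  · intro h n
    obtain ⟨p, hp, h1, h2⟩ := h n
    exact ⟨p.swap, hp, h2, h1⟩
  · intro h n
    obtain ⟨p, hp, h1, h2⟩ := h n
    exact ⟨p.swap, by simpa using hp, h2, h1⟩

theorem exists_matched (hR : BackForth R) (h : PairSystem R A B L) {a : W} (ha : a ∈ A) :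
    ∃ b ∈ B, Matched L a b := by
  choose p hp hap using fun n => (h.part n).cover_left a ha
  have hmono : ∀ n, (p (n + 1)).2 ⊆ (p n).2 := by
    intro n
    obtain ⟨q, hq, hq1, hq2⟩ := h.refines n _ (hp (n + 1))
    have := (h.part n).unique_left _ hq _ (hp n) a (hq1 (hap (n + 1))) (hap n)
    rwa [this] at hq2
  have hco : ∀ n, IsCompactOpen (p n).2 := fun n => hR.right ((h.part n).rel _ (hp n))
  obtain ⟨b, hb⟩ := IsCompact.nonempty_iInter_of_sequence_nonempty_isCompact_isClosed
    (fun n => (p n).2) hmono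
    (fun n => (hR.nonempty_iff ((h.part n).rel _ (hp n))).1 ⟨a, hap n⟩) (hco 0).1
    (fun n => (hco n).isClosed)
  rw [Set.mem_iInter] at hb
  exact ⟨b, (h.part 0).subset_right _ (hp 0) (hb 0), fun n => ⟨p n, hp n, hap n, hb n⟩⟩

theorem Matched.eq (h : PairSystem R A B L) {a b b' : W} (hb : Matched L a b)
    (hb' : Matched L a b') : b = b' := by
  by_contra hne
  obtain ⟨n, hn⟩ := h.small_right b {b'}ᶜ (isOpen_compl_singleton.mem_nhds hne)
  obtain ⟨p, hp, hap, hbp⟩ := hb n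
  obtain ⟨q, hq, haq, hbq⟩ := hb' n
  have := (h.part n).unique_left _ hp _ hq a hap haq
  subst this
  exact hn p hp hbp hbq rfl

theorem Matched.exists_small (h : PairSystem R A B L) {a b : W} (hab : Matched L a b) {N : Set W}
    (hN : N ∈ 𝓝 b) : ∃ U V, R U V ∧ a ∈ U ∧ V ⊆ N ∧
      ∀ a' b', Matched L a' b' → a' ∈ U → b' ∈ V := by
  obtain ⟨n, hn⟩ := h.small_right b N hN
  obtain ⟨p, hp, hap, hbp⟩ := hab n
  refine ⟨p.1, p.2, (h.part n).rel _ hp, hap, hn p hp hbp, fun a' b' hab' ha' => ?_⟩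
  obtain ⟨q, hq, haq, hbq⟩ := hab' n
  rwa [(h.part n).unique_left _ hp _ hq a' ha' haq]

end PairSystem

/-- Vaught's theorem: sets related by a back-and-forth relation are homeomorphic, by a
homeomorphism that matches arbitrarily small related sets. -/
theorem BackForth.exists_homeomorph [LocallyCompactSpace W] [TotallyDisconnectedSpace W]
    [SecondCountableTopology W] {R : Set W → Set W → Prop} (hR : BackForth R) {A B : Set W}
    (hAB : R A B) : ∃ h : A ≃ₜ B, ∀ a : A, ∀ N ∈ 𝓝 (h a : W),
      ∃ U V, R U V ∧ (a : W) ∈ U ∧ V ⊆ N := by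
  obtain ⟨L, hL⟩ := exists_pairSystem hR hAB
  choose f hfB hf using fun a : A => hL.exists_matched hR a.2
  choose g hgA hg using fun b : B => hL.swap.exists_matched hR.swap b.2
  replace hg : ∀ b : B, PairSystem.Matched L (g b) b := fun b => PairSystem.matched_swap.1 (hg b)
  have hfc : Continuous fun a : A => (⟨f a, hfB a⟩ : B) := by
    refine continuous_induced_rng.2 (continuous_iff_continuousAt.2 fun a => ?_)
    intro N hN
    obtain ⟨U, V, hUV, haU, hVN, hm⟩ := (hf a).exists_small hL hN
    refine Filter.mem_map.2 (Filter.mem_of_superset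
      (((hR.left hUV).2.preimage continuous_subtype_val).mem_nhds haU) ?_)
    exact fun a' ha' => hVN (hm _ _ (hf a') ha')
  have hgc : Continuous fun b : B => (⟨g b, hgA b⟩ : A) := by
    refine continuous_induced_rng.2 (continuous_iff_continuousAt.2 fun b => ?_)
    intro N hN
    obtain ⟨U, V, hUV, haU, hVN, hm⟩ :=
      (PairSystem.matched_swap.2 (hg b)).exists_small hL.swap hN
    refine Filter.mem_map.2 (Filter.mem_of_superset
      (((hR.swap.left hUV).2.preimage continuous_subtype_val).mem_nhds haU) ?_)
    exact fun b' hb' => hVN (hm _ _ (PairSystem.matched_swap.2 (hg b')) hb')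
  refine ⟨⟨⟨fun a => ⟨f a, hfB a⟩, fun b => ⟨g b, hgA b⟩, fun a => ?_, fun b => ?_⟩, hfc, hgc⟩, ?_⟩
  · exact Subtype.ext (PairSystem.Matched.eq hL.swap (PairSystem.matched_swap.2 (hg ⟨f a, hfB a⟩))
      (PairSystem.matched_swap.2 (hf a)))
  · exact Subtype.ext (PairSystem.Matched.eq hL (hf ⟨g b, hgA b⟩) (hg b))
  · intro a N hN
    obtain ⟨U, V, hUV, haU, hVN, -⟩ := (hf a).exists_small hL hN
    exact ⟨U, V, hUV, haU, hVN⟩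

end BackForth

/-! ### Isomorphism of ideals of compact open sets -/

section IdealIso

variable {W : Type*} [TopologicalSpace W]

theorem IdealIso.refl (A : Set W) : IdealIso A A := ⟨OrderIso.refl _⟩

theorem IdealIso.symm {A B : Set W} (h : IdealIso A B) : IdealIso B A := h.map OrderIso.symm

theorem IdealIso.trans {A B C : Set W} (h : IdealIso A B) (h' : IdealIso B C) : IdealIso A C :=
  h.elim fun e => h'.elim fun f => ⟨e.trans f⟩

/-- Mutually inverse monotone maps of compact open sets give an isomorphism of ideals. -/
theorem idealIso_of_equiv {A B : Set W} (f g : Set W → Set W)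
    (hf : ∀ C ∈ coIdeal A, f C ∈ coIdeal B) (hg : ∀ C ∈ coIdeal B, g C ∈ coIdeal A)
    (hgf : ∀ C ∈ coIdeal A, g (f C) = C) (hfg : ∀ C ∈ coIdeal B, f (g C) = C)
    (hfm : ∀ C D, C ⊆ D → f C ⊆ f D) (hgm : ∀ C D, C ⊆ D → g C ⊆ g D) : IdealIso A B :=
  ⟨{ toFun := fun C => ⟨f C.1, hf _ C.2⟩
     invFun := fun C => ⟨g C.1, hg _ C.2⟩
     left_inv := fun C => Subtype.ext (hgf _ C.2)
     right_inv := fun C => Subtype.ext (hfg _ C.2)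
     map_rel_iff' := by
       intro C D
       refine ⟨fun h => ?_, fun h => hfm _ _ h⟩
       have : g (f C.1) ⊆ g (f D.1) := hgm _ _ h
       rwa [hgf _ C.2, hgf _ D.2] at this }⟩

theorem idealIso_of_homeomorph {A B : Set W} (hA : IsOpen A) (hB : IsOpen B) (h : A ≃ₜ B) :
    IdealIso A B := by
  have key : ∀ {A B : Set W}, IsOpen B → ∀ h : A ≃ₜ B, ∀ C ∈ coIdeal A,
      ((↑) '' (h '' ((↑) ⁻¹' C)) : Set W) ∈ coIdeal B := by
    intro A B hB h C hC
    refine ⟨?_, ?_, by simp⟩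
    · refine IsCompact.image ?_ continuous_subtype_val
      refine IsCompact.image ?_ h.continuous
      rw [Subtype.isCompact_iff, Subtype.image_preimage_coe, Set.inter_eq_self_of_subset_right hC.2.2]
      exact hC.1
    · exact hB.isOpenMap_subtype_val _ (h.isOpenMap _ (hC.2.1.preimage continuous_subtype_val))
  have key2 : ∀ {A B : Set W}, ∀ h : A ≃ₜ B, ∀ C ∈ coIdeal A,
      ((↑) '' (h.symm '' ((↑) ⁻¹' ((↑) '' (h '' ((↑) ⁻¹' C)) : Set W))) : Set W) = C := by
    intro A B h C hC
    rw [Set.preimage_image_eq _ Subtype.val_injective, ← Set.image_comp h.symm]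
    simp [Subtype.image_preimage_coe, hC.2.2]
  exact idealIso_of_equiv (fun C => (↑) '' (h '' ((↑) ⁻¹' C)))
    (fun C => (↑) '' (h.symm '' ((↑) ⁻¹' C))) (key hB h) (key hA h.symm) (key2 h)
    (fun C hC => by simpa using key2 h.symm C hC)
    (fun C D h => by gcongr) (fun C D h => by gcongr)

theorem idealIso_image (h : W ≃ₜ W) (A : Set W) : IdealIso A (h '' A) := by
  refine idealIso_of_equiv (fun C => h '' C) (fun C => h.symm '' C) ?_ ?_ ?_ ?_ ?_ ?_
  · exact fun C hC => ⟨hC.1.image h.continuous, h.isOpenMap _ hC.2.1, Set.image_mono hC.2.2⟩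
  · refine fun C hC => ⟨hC.1.image h.symm.continuous, h.symm.isOpenMap _ hC.2.1, ?_⟩
    have := Set.image_mono (f := h.symm) hC.2.2
    simpa [← Set.image_comp] using this
  · intro C _; simp [← Set.image_comp]
  · intro C _; simp [← Set.image_comp]
  · exact fun C D hCD => Set.image_mono hCD
  · exact fun C D hCD => Set.image_mono hCD

variable [T2Space W]

/-- The Boolean ring of a disjoint union is the product of the Boolean rings. -/
def coIdealUnion {A B : Set W} (hA : IsCompactOpen A) (hB : IsCompactOpen B)
    (hAB : Disjoint A B) : coIdeal (A ∪ B) ≃o coIdeal A × coIdeal B where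
  toFun C := (⟨C.1 ∩ A, C.2.1.inter_right hA.isClosed, C.2.2.1.inter hA.2, Set.inter_subset_right⟩,
    ⟨C.1 ∩ B, C.2.1.inter_right hB.isClosed, C.2.2.1.inter hB.2, Set.inter_subset_right⟩)
  invFun p := ⟨p.1.1 ∪ p.2.1, p.1.2.1.union p.2.2.1, p.1.2.2.1.union p.2.2.2.1,
    Set.union_subset_union p.1.2.2.2 p.2.2.2.2⟩
  left_inv C := by
    refine Subtype.ext ?_
    simp only
    rw [← Set.inter_union_distrib_left, Set.inter_eq_self_of_subset_left C.2.2.2]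
  right_inv p := by
    obtain ⟨⟨C, hC⟩, ⟨D, hD⟩⟩ := p
    have h1 : D ∩ A = ∅ := (hAB.symm.mono_left hD.2.2).inter_eq
    have h2 : C ∩ B = ∅ := (hAB.mono_left hC.2.2).inter_eq
    refine Prod.ext (Subtype.ext ?_) (Subtype.ext ?_)
    · simp [Set.union_inter_distrib_right, h1, hC.2.2]
    · simp [Set.union_inter_distrib_right, h2, hD.2.2]
  map_rel_iff' := by
    rintro ⟨C, hC⟩ ⟨D, hD⟩
    constructor
    · rintro ⟨h1, h2⟩ z hz
      rcases hC.2.2 hz with hzA | hzB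
      · exact (h1 ⟨hz, hzA⟩).1
      · exact (h2 ⟨hz, hzB⟩).1
    · intro h
      exact ⟨Set.inter_subset_inter_left _ h, Set.inter_subset_inter_left _ h⟩

theorem IdealIso.union {A B A' B' : Set W} (hA : IsCompactOpen A) (hB : IsCompactOpen B)
    (hA' : IsCompactOpen A') (hB' : IsCompactOpen B') (hAB : Disjoint A B) (hAB' : Disjoint A' B')
    (h₁ : IdealIso A A') (h₂ : IdealIso B B') : IdealIso (A ∪ B) (A' ∪ B') :=
  h₁.elim fun e => h₂.elim fun f => ⟨(coIdealUnion hA hB hAB).trans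
    ((prodOrderIso e f).trans (coIdealUnion hA' hB' hAB').symm)⟩

/-- The set `A` splits into disjoint compact open copies of `A` and `B`. -/
def AbsorbsCopy (A B : Set W) : Prop :=
  ∃ A' B', IsCompactOpen A' ∧ IsCompactOpen B' ∧ Disjoint A' B' ∧ A' ∪ B' = A ∧
    IdealIso A' A ∧ IdealIso B' B

theorem AbsorbsCopy.prodIdealIso {A B : Set W} (h : AbsorbsCopy A B) : ProdIdealIso A B := by
  obtain ⟨A', B', hA', hB', hd, hu, ⟨e⟩, ⟨f⟩⟩ := h
  have g := (coIdealUnion hA' hB' hd).trans (prodOrderIso e f)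
  rw [hu] at g
  exact ⟨g.symm⟩

theorem idealIso_fst_of_prod {A₁ A₂ B : Set W} (hA₁ : IsCompactOpen A₁)
    (e : coIdeal A₁ × coIdeal A₂ ≃o coIdeal B) (z : coIdeal A₂) (hz : z.1 = ∅) :
    IdealIso A₁ (e (⟨A₁, hA₁.1, hA₁.2, subset_rfl⟩, z)).1 := by
  set V := e (⟨A₁, hA₁.1, hA₁.2, subset_rfl⟩, z) with hV
  have hz' : ∀ y, z ≤ y := fun y => by
    change z.1 ⊆ y.1
    simp [hz]
  have hle : ∀ C : coIdeal A₁, e (C, z) ≤ V := fun C => e.monotone ⟨C.2.2.2, le_rfl⟩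
  have hsnd : ∀ C : coIdeal B, C ≤ V → (e.symm C).2 = z := fun C hC => by
    have h : e.symm C ≤ (⟨A₁, hA₁.1, hA₁.2, subset_rfl⟩, z) := by
      rw [e.symm_apply_le]; exact hC
    exact le_antisymm h.2 (hz' _)
  have hsub : ∀ C ∈ coIdeal V.1, C ∈ coIdeal B := fun C hC =>
    ⟨hC.1, hC.2.1, hC.2.2.trans V.2.2.2⟩
  refine ⟨{ toFun := fun C => ⟨(e (C, z)).1, (e (C, z)).2.1, (e (C, z)).2.2.1, hle C⟩
            invFun := fun C => (e.symm ⟨C.1, hsub _ C.2⟩).1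
            left_inv := fun C => ?_
            right_inv := fun C => ?_
            map_rel_iff' := ?_ }⟩
  · simp
  · refine Subtype.ext ?_
    have h := hsnd ⟨C.1, hsub _ C.2⟩ C.2.2.2
    simp only
    rw [← h, Prod.mk.eta, e.apply_symm_apply]
  · intro C D
    change e (C, z) ≤ e (D, z) ↔ C ≤ D
    rw [e.le_iff_le]
    exact ⟨fun h => h.1, fun h => ⟨h, le_rfl⟩⟩

/-- A product decomposition of the ring of `B` comes from a decomposition of `B`. -/
theorem exists_decomposition_of_prod {A₁ A₂ B : Set W} (hA₁ : IsCompactOpen A₁)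
    (hA₂ : IsCompactOpen A₂) (hB : IsCompactOpen B)
    (e : coIdeal A₁ × coIdeal A₂ ≃o coIdeal B) :
    ∃ V₁ V₂, IsCompactOpen V₁ ∧ IsCompactOpen V₂ ∧ Disjoint V₁ V₂ ∧ V₁ ∪ V₂ = B ∧
      IdealIso V₁ A₁ ∧ IdealIso V₂ A₂ := by
  let bot : ∀ A : Set W, coIdeal A := fun A => ⟨∅, isCompact_empty, isOpen_empty, by simp⟩
  have hbot : ∀ {A : Set W} (C : coIdeal A), bot A ≤ C := fun C => Set.empty_subset C.1
  let T₁ : coIdeal A₁ := ⟨A₁, hA₁.1, hA₁.2, subset_rfl⟩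
  let T₂ : coIdeal A₂ := ⟨A₂, hA₂.1, hA₂.2, subset_rfl⟩
  have hco : ∀ C : coIdeal B, IsCompactOpen C.1 := fun C => ⟨C.2.1, C.2.2.1⟩
  refine ⟨(e (T₁, bot _)).1, (e (bot _, T₂)).1, hco _, hco _, ?_, ?_,
    (idealIso_fst_of_prod hA₁ e (bot _) rfl).symm,
    (idealIso_fst_of_prod hA₂ (OrderIso.prodComm.trans e) (bot _) rfl).symm⟩
  · have hD := (hco (e (T₁, bot _))).inter (hco (e (bot _, T₂)))
    let D : coIdeal B := ⟨_, hD.1, hD.2, Set.inter_subset_left.trans (e (T₁, bot _)).2.2.2⟩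
    have h1 : e.symm D ≤ (T₁, bot _) := by
      rw [e.symm_apply_le]; exact Set.inter_subset_left
    have h2 : e.symm D ≤ (bot _, T₂) := by
      rw [e.symm_apply_le]; exact Set.inter_subset_right
    have h3 : D ≤ bot B := by
      rw [← e.symm.le_iff_le]
      exact ⟨h2.1.trans (hbot _), h1.2.trans (hbot _)⟩
    exact Set.disjoint_iff.2 h3
  · have hD := (hco (e (T₁, bot _))).union (hco (e (bot _, T₂)))
    let D : coIdeal B := ⟨_, hD.1, hD.2,
      Set.union_subset (e (T₁, bot _)).2.2.2 (e (bot _, T₂)).2.2.2⟩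
    have h1 : (T₁, bot _) ≤ e.symm D := by
      rw [e.le_symm_apply]; exact Set.subset_union_left
    have h2 : (bot _, T₂) ≤ e.symm D := by
      rw [e.le_symm_apply]; exact Set.subset_union_right
    have h3 : (⟨B, hB.1, hB.2, subset_rfl⟩ : coIdeal B) ≤ D := by
      rw [← e.symm.le_iff_le]
      exact ⟨(e.symm _).1.2.2.2.trans h1.1, (e.symm _).2.2.2.2.trans h2.2⟩
    exact Set.Subset.antisymm D.2.2.2 h3

theorem ProdIdealIso.absorbsCopy {A B : Set W} (hA : IsCompactOpen A) (hB : IsCompactOpen B)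
    (h : ProdIdealIso A B) : AbsorbsCopy A B :=
  h.elim fun e => exists_decomposition_of_prod hA hB hA e

theorem IdealIso.exists_split {A B : Set W} (h : IdealIso A B) (hA : IsCompactOpen A)
    (hB : IsCompactOpen B) {U : Set W} (hU : IsCompactOpen U) (hUA : U ⊆ A) :
    ∃ V ⊆ B, IsCompactOpen V ∧ IdealIso U V ∧ IdealIso (A \ U) (B \ V) := by
  obtain ⟨e⟩ := h
  have g := coIdealUnion hU (hA.diff hU) Set.disjoint_sdiff_right
  rw [Set.union_sdiff_cancel hUA] at g
  obtain ⟨V₁, V₂, hV₁, hV₂, hd, hu, h1, h2⟩ :=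
    exists_decomposition_of_prod hU (hA.diff hU) hB (g.symm.trans e)
  refine ⟨V₁, hu ▸ Set.subset_union_left, hV₁, h1.symm, ?_⟩
  rw [← hu, Set.union_sdiff_cancel_left hd.le_bot]
  exact h2.symm

/-- A compact open copy of `A` inside `B`. -/
def EmbedsIn (A B : Set W) : Prop := ∃ C ⊆ B, IsCompactOpen C ∧ IdealIso C A

theorem IdealIso.nonempty_iff {A B : Set W} (h : IdealIso A B) (hA : IsCompactOpen A)
    (hB : IsCompactOpen B) : A.Nonempty ↔ B.Nonempty := by
  have key : ∀ {A B : Set W}, IdealIso A B → IsCompactOpen A → A.Nonempty → B.Nonempty := by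
    rintro A B ⟨e⟩ hA ⟨a, ha⟩
    by_contra hB
    rw [Set.not_nonempty_iff_eq_empty] at hB
    subst hB
    have hs : ∀ C : coIdeal (∅ : Set W), C.1 = ∅ := fun C => Set.subset_empty_iff.1 C.2.2.2
    have h : (⟨A, hA.1, hA.2, subset_rfl⟩ : coIdeal A) =
        ⟨∅, isCompact_empty, isOpen_empty, Set.empty_subset _⟩ :=
      e.injective (Subtype.ext ((hs _).trans (hs _).symm))
    have h' : A = ∅ := congrArg Subtype.val h
    simp [h'] at ha
  exact ⟨key h hA, key h.symm hB⟩

end IdealIso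

/-! ### Pseudo-indecomposable sets -/

section PI

variable {W : Type*} [TopologicalSpace W]

theorem IsPISet.isCompactOpen {A : Set W} (hA : IsPISet A) : IsCompactOpen A :=
  ⟨hA.2.1, hA.2.2.1⟩

variable [T2Space W]

theorem EmbedsIn.mono {A B C : Set W} (h : EmbedsIn A B) (hBC : B ⊆ C) : EmbedsIn A C :=
  let ⟨D, hD, h'⟩ := h
  ⟨D, hD.trans hBC, h'⟩

theorem IdealIso.embedsIn {A B : Set W} (h : IdealIso A B) (hB : IsCompactOpen B) :
    EmbedsIn A B := ⟨B, subset_rfl, hB, h.symm⟩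

theorem EmbedsIn.trans {A B C : Set W} (hB : IsCompactOpen B)
    (h₁ : EmbedsIn A B) (h₂ : EmbedsIn B C) : EmbedsIn A C := by
  obtain ⟨A', hA'B, hA', hA'A⟩ := h₁
  obtain ⟨B', hB'C, hB', hB'B⟩ := h₂
  obtain ⟨V, hVB, hV, hVA, -⟩ := hB'B.symm.exists_split hB hB' hA' hA'B
  exact ⟨V, hVB.trans hB'C, hV, hVA.symm.trans hA'A⟩

theorem IsPISet.of_idealIso {A B : Set W} (hA : IsPISet A) (hB : IsCompactOpen B)
    (h : IdealIso A B) : IsPISet B := by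
  refine ⟨(h.nonempty_iff hA.isCompactOpen hB).1 hA.1, hB.1, hB.2, fun U hU hU' hUB => ?_⟩
  obtain ⟨V, hVA, hV, h1, h2⟩ := h.symm.exists_split hB hA.isCompactOpen ⟨hU, hU'⟩ hUB
  rcases hA.2.2.2 V hV.1 hV.2 hVA with h' | h'
  · exact Or.inl ((h1.trans h').trans h)
  · exact Or.inr ((h2.trans h').trans h)

theorem IsPISet.embedsIn_or {A U U₁ : Set W} (hA : IsPISet A) (h : EmbedsIn A U)
    (hU₁ : IsCompactOpen U₁) : EmbedsIn A U₁ ∨ EmbedsIn A (U \ U₁) := by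
  obtain ⟨C, hCU, hC, hCA⟩ := h
  have hPI := hA.of_idealIso hC hCA.symm
  have hI := hC.inter hU₁
  rcases hPI.2.2.2 (C ∩ U₁) hI.1 hI.2 Set.inter_subset_left with h' | h'
  · exact Or.inl ⟨_, Set.inter_subset_right, hI, h'.trans hCA⟩
  · refine Or.inr ⟨_, ?_, hC.diff hI, h'.trans hCA⟩
    exact fun z hz => ⟨hCU hz.1, fun hz' => hz.2 ⟨hz.1, hz'⟩⟩

/-- Compact open sets that are isomorphic or both bi-embeddable with `A`. -/
def BiembedRel (A U V : Set W) : Prop :=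
  IsCompactOpen U ∧ IsCompactOpen V ∧ (IdealIso U V ∨
    (EmbedsIn A U ∧ EmbedsIn U A ∧ EmbedsIn A V ∧ EmbedsIn V A))

theorem BiembedRel.symm {A U V : Set W} (h : BiembedRel A U V) : BiembedRel A V U :=
  ⟨h.2.1, h.1, h.2.2.imp IdealIso.symm fun h => ⟨h.2.2.1, h.2.2.2, h.1, h.2.1⟩⟩

theorem embedsIn_of_subset {A U V : Set W} (hV : IsCompactOpen V) (hU : IsCompactOpen U)
    (h : EmbedsIn V A) (hUV : U ⊆ V) : EmbedsIn U A :=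
  EmbedsIn.trans hV ⟨U, hUV, hU, IdealIso.refl U⟩ h

theorem BiembedRel.forth_of_embedsIn_diff {A U V U₂ : Set W} (hA : IsCompactOpen A)
    (hU : IsCompactOpen U) (hV : IsCompactOpen V)
    (hUA : EmbedsIn U A) (hAV : EmbedsIn A V) (hVA : EmbedsIn V A) (hU₂ : IsCompactOpen U₂)
    (hU₂U : U₂ ⊆ U) (h : EmbedsIn A (U \ U₂)) :
    ∃ V₂ ⊆ V, BiembedRel A U₂ V₂ ∧ BiembedRel A (U \ U₂) (V \ V₂) := by
  obtain ⟨U', hU'V, hU', hU'U⟩ := hUA.trans hA hAV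
  obtain ⟨V₂, hV₂, hV₂c, h1, h2⟩ := hU'U.symm.exists_split hU hU' hU₂ hU₂U
  have hd := hU.diff hU₂
  refine ⟨V₂, hV₂.trans hU'V, ⟨hU₂, hV₂c, Or.inl h1⟩, hd, hV.diff hV₂c, Or.inr ⟨h, ?_, ?_, ?_⟩⟩
  · exact embedsIn_of_subset hU hd hUA Set.sdiff_subset
  · exact (h.trans hd (h2.embedsIn (hU'.diff hV₂c))).mono (Set.sdiff_subset_sdiff_left hU'V)
  · exact embedsIn_of_subset hV (hV.diff hV₂c) hVA Set.sdiff_subset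

theorem BiembedRel.forth {A U V U₁ : Set W} (hA : IsPISet A) (h : BiembedRel A U V)
    (hU₁U : U₁ ⊆ U) (hU₁ : IsCompactOpen U₁) :
    ∃ V₁ ⊆ V, BiembedRel A U₁ V₁ ∧ BiembedRel A (U \ U₁) (V \ V₁) := by
  obtain ⟨hU, hV, h | ⟨hAU, hUA, hAV, hVA⟩⟩ := h
  · obtain ⟨V₁, hV₁, hV₁c, h1, h2⟩ := h.exists_split hU hV hU₁ hU₁U
    exact ⟨V₁, hV₁, ⟨hU₁, hV₁c, Or.inl h1⟩, hU.diff hU₁, hV.diff hV₁c, Or.inl h2⟩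
  · rcases hA.embedsIn_or hAU hU₁ with h | h
    · obtain ⟨V₂, hV₂, h1, h2⟩ := forth_of_embedsIn_diff hA.isCompactOpen hU hV hUA hAV hVA
        (hU.diff hU₁) Set.sdiff_subset (by rwa [Set.sdiff_sdiff_cancel_left hU₁U])
      rw [Set.sdiff_sdiff_cancel_left hU₁U] at h2
      exact ⟨V \ V₂, Set.sdiff_subset, h2, by rwa [Set.sdiff_sdiff_cancel_left hV₂]⟩
    · exact forth_of_embedsIn_diff hA.isCompactOpen hU hV hUA hAV hVA hU₁ hU₁U h

theorem backForth_biembedRel {A : Set W} (hA : IsPISet A) : BackForth (BiembedRel A) where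
  left h := h.1
  right h := h.2.1
  nonempty_iff := by
    have hne : ∀ {V}, EmbedsIn A V → V.Nonempty := by
      rintro V ⟨C, hCV, hC, hCA⟩
      exact ((hCA.nonempty_iff hC hA.isCompactOpen).2 hA.1).mono hCV
    rintro U V ⟨hU, hV, h | ⟨h1, -, h2, -⟩⟩
    · exact h.nonempty_iff hU hV
    · exact ⟨fun _ => hne h2, fun _ => hne h1⟩
  forth h U₁ hU₁ hc := h.forth hA hU₁ hc
  back h V₁ hV₁ hc :=
    let ⟨U₁, hU₁, h1, h2⟩ := h.symm.forth hA hV₁ hc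
    ⟨U₁, hU₁, h1.symm, h2.symm⟩

variable [LocallyCompactSpace W] [TotallyDisconnectedSpace W] [SecondCountableTopology W]

/-- A Cantor–Schröder–Bernstein property of pseudo-indecomposable sets. -/
theorem IsPISet.idealIso_of_embedsIn {A D : Set W} (hA : IsPISet A) (hD : IsCompactOpen D)
    (h₁ : EmbedsIn A D) (h₂ : EmbedsIn D A) : IdealIso D A := by
  have hAA : EmbedsIn A A := (IdealIso.refl A).embedsIn hA.isCompactOpen
  obtain ⟨h, -⟩ := (backForth_biembedRel hA).exists_homeomorph
    (show BiembedRel A D A from ⟨hD, hA.isCompactOpen, Or.inr ⟨h₁, h₂, hAA, hAA⟩⟩)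
  exact idealIso_of_homeomorph hD.2 hA.2.2.1 h

theorem IsPISet.absorbsCopy {A B A' B' : Set W} (hA : IsPISet A) (hA' : IsCompactOpen A')
    (hB' : IsCompactOpen B') (hd : Disjoint A' B') (hA'A : A' ⊆ A) (hB'A : B' ⊆ A)
    (h₁ : IdealIso A' A) (h₂ : IdealIso B' B) : AbsorbsCopy A B := by
  refine ⟨A \ B', B', hA.isCompactOpen.diff hB', hB', Set.disjoint_sdiff_left,
    Set.sdiff_union_of_subset hB'A, ?_, h₂⟩
  refine hA.idealIso_of_embedsIn (hA.isCompactOpen.diff hB') ⟨A', ?_, hA', h₁⟩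
    ⟨A \ B', Set.sdiff_subset, hA.isCompactOpen.diff hB', IdealIso.refl _⟩
  exact fun z hz => ⟨hA'A hz, Set.disjoint_left.1 hd hz⟩

/-- A pseudo-indecomposable set has a point all of whose neighbourhoods contain a copy of it. -/
theorem IsPISet.exists_special {A : Set W} (hA : IsPISet A) :
    ∃ x ∈ A, ∀ D ⊆ A, IsCompactOpen D → x ∈ D → IdealIso D A := by
  by_contra! hcon
  have hiso : ∀ D ⊆ A, IsCompactOpen D → EmbedsIn A D → IdealIso D A := fun D hDA hD h =>
    hA.idealIso_of_embedsIn hD h ⟨D, hDA, hD, IdealIso.refl D⟩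
  have hfalse : ∃ t, A ⊆ t ∧ IsCompactOpen t ∧ ¬ EmbedsIn A t := by
    refine hA.2.1.induction_on (p := fun s => ∃ t, s ⊆ t ∧ IsCompactOpen t ∧ ¬ EmbedsIn A t)
      ⟨∅, subset_rfl, IsCompactOpen.empty, ?_⟩ ?_ ?_ ?_
    · rintro ⟨C, hC, hCc, hCA⟩
      exact ((hCA.nonempty_iff hCc hA.isCompactOpen).2 hA.1).ne_empty (Set.subset_empty_iff.1 hC)
    · rintro s t hst ⟨r, hr, h⟩
      exact ⟨r, hst.trans hr, h⟩
    · rintro s s' ⟨t, hst, ht, hn⟩ ⟨t', hst', ht', hn'⟩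
      refine ⟨t ∪ t', Set.union_subset_union hst hst', ht.union ht', fun h => ?_⟩
      rcases hA.embedsIn_or h ht with h | h
      · exact hn h
      · exact hn' (h.mono fun z hz => hz.1.resolve_left hz.2)
    · intro x hx
      obtain ⟨D, hDA, hD, hxD, hni⟩ := hcon x hx
      exact ⟨D, mem_nhdsWithin_of_mem_nhds (hD.2.mem_nhds hxD), D, subset_rfl, hD,
        fun h => hni (hiso D hDA hD h)⟩
  obtain ⟨t, hAt, ht, hn⟩ := hfalse
  exact hn ⟨A, hAt, hA.isCompactOpen, IdealIso.refl A⟩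

end PI

/-! ### The canonical partition -/

section Canonical

variable {W : Type*} [TopologicalSpace W]

/-- The class of a pseudo-indecomposable set in the structure diagram. -/
def piClass {A : Set W} (hA : IsPISet A) : SDiagram W := Quotient.mk (piIsoSetoid W) ⟨A, hA⟩

theorem piClass_eq_iff {A B : Set W} {hA : IsPISet A} {hB : IsPISet B} :
    piClass hA = piClass hB ↔ IdealIso A B :=
  ⟨fun h => Quotient.exact h, fun h => Quotient.sound h⟩

theorem exists_piClass_eq (p : SDiagram W) : ∃ (A : Set W) (hA : IsPISet A), piClass hA = p := by
  obtain ⟨⟨A, hA⟩, rfl⟩ := Quotient.exists_rep p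
  exact ⟨A, hA, rfl⟩

theorem mem_canonicalBlock {p : SDiagram W} {w : W} : w ∈ canonicalBlock p ↔
    ∀ U ∈ 𝓝 w, ∃ (A : Set W) (hA : IsPISet A), piClass hA = p ∧ w ∈ A ∧ A ⊆ U := by
  constructor
  · intro h U hU
    obtain ⟨⟨A, hA⟩, h1, h2⟩ := h U hU
    exact ⟨A, hA, h1, h2⟩
  · intro h U hU
    obtain ⟨A, hA, h1, h2⟩ := h U hU
    exact ⟨⟨A, hA⟩, h1, h2⟩

variable [T2Space W]

theorem piClass_lt_iff {A B : Set W} {hA : IsPISet A} {hB : IsPISet B} :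
    (SDiagramPO W).lt (piClass hA) (piClass hB) ↔ AbsorbsCopy A B := by
  constructor
  · rintro ⟨⟨A', hA'⟩, ⟨B', hB'⟩, h1, h2, ⟨e⟩⟩
    obtain ⟨f⟩ := piClass_eq_iff.1 (h1 : piClass hA = piClass hA')
    obtain ⟨g⟩ := piClass_eq_iff.1 (h2 : piClass hB = piClass hB')
    exact ProdIdealIso.absorbsCopy hA.isCompactOpen hB.isCompactOpen
      ⟨(prodOrderIso f g).trans (e.trans f.symm)⟩
  · intro h
    exact ⟨⟨A, hA⟩, ⟨B, hB⟩, rfl, rfl, h.prodIdealIso⟩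

variable [LocallyCompactSpace W] [TotallyDisconnectedSpace W] [SecondCountableTopology W]

theorem IsPISet.exists_mem_canonicalBlock {A : Set W} (hA : IsPISet A) :
    ∃ x ∈ A, x ∈ canonicalBlock (piClass hA) := by
  obtain ⟨x, hxA, hx⟩ := hA.exists_special
  refine ⟨x, hxA, mem_canonicalBlock.2 fun U hU => ?_⟩
  obtain ⟨C, hC, hxC, hCU⟩ :=
    exists_isCompactOpen_subset (Filter.inter_mem hU (hA.2.2.1.mem_nhds hxA))
  have h := hx C (hCU.trans Set.inter_subset_right) hC hxC
  have hPI := hA.of_idealIso hC h.symm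
  exact ⟨C, hPI, piClass_eq_iff.2 h, hxC, hCU.trans Set.inter_subset_left⟩

theorem IsPISet.ptype_canonicalBlock {A : Set W} (hA : IsPISet A) :
    ptype canonicalBlock A = {q | (SDiagramPO W).le (piClass hA) q} := by
  ext q
  constructor
  · rintro ⟨w, hwA, hw⟩
    obtain ⟨B, hB, rfl, hwB, hBA⟩ := mem_canonicalBlock.1 hw A (hA.2.2.1.mem_nhds hwA)
    rcases hA.2.2.2 B hB.2.1 hB.2.2.1 hBA with h | h
    · exact Or.inr (piClass_eq_iff.2 h.symm)
    · refine Or.inl (piClass_lt_iff.2 ?_)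
      exact ⟨A \ B, B, hA.isCompactOpen.diff hB.isCompactOpen, hB.isCompactOpen,
        Set.disjoint_sdiff_left, Set.sdiff_union_of_subset hBA, h, IdealIso.refl B⟩
  · rintro (h | rfl)
    · obtain ⟨B, hB, rfl⟩ := exists_piClass_eq q
      obtain ⟨A', B', -, hB', -, hu, -, hBB⟩ := piClass_lt_iff.1 h
      have hPI := hB.of_idealIso hB' hBB.symm
      obtain ⟨x, hx, hx'⟩ := hPI.exists_mem_canonicalBlock
      rw [(piClass_eq_iff (hB := hB)).2 hBB] at hx'
      exact ⟨x, hu ▸ Or.inr hx, hx'⟩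
    · exact hA.exists_mem_canonicalBlock

theorem IsPISet.le_of_mem {A : Set W} (hA : IsPISet A) {w : W} (hw : w ∈ A) {q : SDiagram W}
    (hq : w ∈ canonicalBlock q) : (SDiagramPO W).le (piClass hA) q := by
  have : q ∈ ptype canonicalBlock A := ⟨w, hw, hq⟩
  rwa [hA.ptype_canonicalBlock] at this

theorem canonicalBlock_unique {p q : SDiagram W} {w : W} (hp : w ∈ canonicalBlock p)
    (hq : w ∈ canonicalBlock q) : p = q := by
  obtain ⟨A, hA, rfl, hwA, -⟩ := mem_canonicalBlock.1 hp _ Filter.univ_mem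
  obtain ⟨B, hB, rfl, hwB, -⟩ := mem_canonicalBlock.1 hq _ Filter.univ_mem
  exact POSystem.le_antisymm _ (hA.le_of_mem hwA hq) (hB.le_of_mem hwB hp)

theorem IsPISet.lt_self_of_ne {A : Set W} (hA : IsPISet A) {w x : W} (hw : w ∈ A) (hx : x ∈ A)
    (hwp : w ∈ canonicalBlock (piClass hA)) (hxp : x ∈ canonicalBlock (piClass hA))
    (hne : w ≠ x) : (SDiagramPO W).lt (piClass hA) (piClass hA) := by
  obtain ⟨U, V, hU, hV, hwU, hxV, hUV⟩ := t2_separation hne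
  obtain ⟨B, hB, hBp, hwB, hBU⟩ := mem_canonicalBlock.1 hwp _
    (Filter.inter_mem (hU.mem_nhds hwU) (hA.2.2.1.mem_nhds hw))
  obtain ⟨C, hC, hCp, hxC, hCV⟩ := mem_canonicalBlock.1 hxp _
    (Filter.inter_mem (hV.mem_nhds hxV) (hA.2.2.1.mem_nhds hx))
  refine piClass_lt_iff.2 (hA.absorbsCopy hB.isCompactOpen hC.isCompactOpen ?_
    (hBU.trans Set.inter_subset_right) (hCV.trans Set.inter_subset_right)
    (piClass_eq_iff.1 hBp) (piClass_eq_iff.1 hCp))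
  exact hUV.mono (hBU.trans Set.inter_subset_left) (hCV.trans Set.inter_subset_left)

theorem IsPISet.isTrimAt {A : Set W} (hA : IsPISet A) :
    IsTrimAt (SDiagramPO W) canonicalBlock A (piClass hA) := by
  refine ⟨hA.2.1, hA.2.2.1, hA.ptype_canonicalBlock, fun hn => ?_⟩
  obtain ⟨x, hx, hxp⟩ := hA.exists_mem_canonicalBlock
  refine ⟨x, ⟨hx, hxp⟩, fun y hy => ?_⟩
  by_contra hne
  exact hn (hA.lt_self_of_ne hy.1 hx hy.2 hxp hne)

theorem isPPartition_canonicalBlock :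
    IsPPartition (SDiagramPO W) (canonicalBlock (W := W)) := by
  refine ⟨fun p => ?_, fun p q hpq => ?_, fun p => ?_⟩
  · obtain ⟨A, hA, rfl⟩ := exists_piClass_eq p
    obtain ⟨x, -, hx⟩ := hA.exists_mem_canonicalBlock
    exact ⟨x, hx⟩
  · exact Set.disjoint_left.2 fun w hp hq => hpq (canonicalBlock_unique hp hq)
  · ext w
    simp only [Set.mem_inter_iff, Set.mem_iUnion, mem_derivedSet, accPt_iff_nhds,
      Set.mem_ofPred_eq, exists_prop]
    constructor
    · rintro ⟨hacc, q, hq⟩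
      refine ⟨q, ?_, hq⟩
      obtain ⟨A, hA, rfl, hwA, -⟩ := mem_canonicalBlock.1 hq _ Filter.univ_mem
      obtain ⟨y, ⟨hyA, hyp⟩, hne⟩ := hacc A (hA.2.2.1.mem_nhds hwA)
      rcases hA.le_of_mem hyA hyp with h | rfl
      · exact h
      · exact hA.lt_self_of_ne hyA hwA hyp hq hne
    · rintro ⟨q, hqp, hq⟩
      refine ⟨fun U hU => ?_, q, hq⟩
      obtain ⟨A, hA, rfl, hwA, hAU⟩ := mem_canonicalBlock.1 hq U hU
      obtain ⟨B, hB, rfl⟩ := exists_piClass_eq p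
      obtain ⟨A', B', hA', hB', hd, hu, hAA, hBB⟩ := piClass_lt_iff.1 hqp
      have hPA := hA.of_idealIso hA' hAA.symm
      have hPB := hB.of_idealIso hB' hBB.symm
      obtain ⟨x, hx, hxp⟩ := hPA.exists_mem_canonicalBlock
      obtain ⟨y, hy, hyp⟩ := hPB.exists_mem_canonicalBlock
      by_cases hwB : w ∈ B'
      · have h := hPB.le_of_mem hwB hq
        rw [(piClass_eq_iff (hB := hB)).2 hBB] at h
        have heq := POSystem.le_antisymm _ h (Or.inl hqp)
        refine ⟨x, ⟨hAU (hu ▸ Or.inl hx), ?_⟩, ?_⟩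
        · rwa [heq, ← piClass_eq_iff.2 hAA]
        · rintro rfl
          exact Set.disjoint_left.1 hd hx hwB
      · refine ⟨y, ⟨hAU (hu ▸ Or.inr hy), ?_⟩, ?_⟩
        · rwa [← piClass_eq_iff.2 hBB]
        · rintro rfl
          exact hwB hy

theorem PrimitiveSpace.exists_isPISet (hW : PrimitiveSpace W) {w : W} {U : Set W}
    (hU : U ∈ 𝓝 w) : ∃ A, IsPISet A ∧ w ∈ A ∧ A ⊆ U := by
  obtain ⟨C, hC, hwC, hCU⟩ := exists_isCompactOpen_subset hU
  obtain ⟨n, F, hF, -, rfl⟩ := hW C hC.1 hC.2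
  obtain ⟨i, hi⟩ := Set.mem_iUnion.1 hwC
  exact ⟨F i, hF i, hi, (Set.subset_iUnion F i).trans hCU⟩

theorem isTrimPartition_canonicalBlock (hW : PrimitiveSpace W) :
    IsTrimPartition (SDiagramPO W) (canonicalBlock (W := W)) := by
  refine ⟨isPPartition_canonicalBlock, fun w U hU => ?_, fun p _ w hw => ?_, fun p w hw => ?_⟩
  · obtain ⟨A, hA, hwA, hAU⟩ := hW.exists_isPISet hU
    exact ⟨A, ⟨_, hA.isTrimAt⟩, hwA, hAU⟩
  · refine mem_canonicalBlock.2 fun U hU => ?_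
    obtain ⟨B, hB, hwB, hBU⟩ := hw U hU
    obtain ⟨A, hA, hwA, hAB⟩ := hW.exists_isPISet (hB.2.1.mem_nhds hwB)
    obtain ⟨C, hC, hwC, hCA⟩ := hw A (hA.2.2.1.mem_nhds hwA)
    refine ⟨A, hA, POSystem.le_antisymm (SDiagramPO W) ?_ ?_, hwA, hAB.trans hBU⟩
    · have : p ∈ ptype canonicalBlock C := by rw [hC.2.2.1]; exact Or.inr rfl
      obtain ⟨x, hx, hxp⟩ := this
      exact hA.le_of_mem (hCA hx) hxp
    · obtain ⟨x, hx, hxp⟩ := hA.exists_mem_canonicalBlock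
      have : piClass hA ∈ ptype canonicalBlock B := ⟨x, hAB hx, hxp⟩
      rwa [hB.2.2.1] at this
  · obtain ⟨A, hA, rfl, hwA, -⟩ := mem_canonicalBlock.1 hw _ Filter.univ_mem
    exact ⟨A, hA.isTrimAt, hwA⟩

end Canonical

/-! ### Trim sets -/

section Trim

variable {W : Type*} [TopologicalSpace W] {Q : Type*} {S : POSystem Q} {Y : Q → Set W}

namespace IsTrimAt

theorem isCompactOpen {A : Set W} {p : Q} (h : IsTrimAt S Y A p) : IsCompactOpen A :=
  ⟨h.1, h.2.1⟩

theorem le_of_mem {A : Set W} {p q : Q} (h : IsTrimAt S Y A p) {z : W} (hz : z ∈ A)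
    (hq : z ∈ Y q) : S.le p q := by
  have : q ∈ ptype Y A := ⟨z, hz, hq⟩
  rwa [h.2.2.1] at this

theorem exists_mem {A : Set W} {p q : Q} (h : IsTrimAt S Y A p) (hpq : S.le p q) :
    ∃ z ∈ A, z ∈ Y q := by
  have : q ∈ ptype Y A := by rw [h.2.2.1]; exact hpq
  exact this

theorem lt_self_of_ne {A : Set W} {p : Q} (h : IsTrimAt S Y A p) {x y : W} (hx : x ∈ A)
    (hy : y ∈ A) (hxp : x ∈ Y p) (hyp : y ∈ Y p) (hne : x ≠ y) : S.lt p p := by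
  by_contra hn
  exact hne ((h.2.2.2 hn).unique ⟨hx, hxp⟩ ⟨hy, hyp⟩)

theorem eq {A : Set W} {p q : Q} (hp : IsTrimAt S Y A p) (hq : IsTrimAt S Y A q) : p = q := by
  obtain ⟨x, hx, hxp⟩ := hp.exists_mem S.le_rfl
  obtain ⟨y, hy, hyq⟩ := hq.exists_mem S.le_rfl
  exact S.le_antisymm (hp.le_of_mem hy hyq) (hq.le_of_mem hx hxp)

/-- A trim set stays trim when points of larger types are added. -/
theorem union {M D : Set W} {q : Q} (hM : IsTrimAt S Y M q) (hD : IsCompactOpen D)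
    (hle : ∀ z ∈ D, ∀ r, z ∈ Y r → S.le q r) (hq : ∀ z ∈ D, z ∉ Y q) :
    IsTrimAt S Y (M ∪ D) q := by
  refine ⟨hM.1.union hD.1, hM.2.1.union hD.2, ?_, fun hn => ?_⟩
  · ext r
    constructor
    · rintro ⟨z, hz | hz, hzr⟩
      exacts [hM.le_of_mem hz hzr, hle z hz r hzr]
    · intro hr
      obtain ⟨z, hz, hzr⟩ := hM.exists_mem hr
      exact ⟨z, Or.inl hz, hzr⟩
  · obtain ⟨x, ⟨hxM, hxq⟩, hu⟩ := hM.2.2.2 hn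
    refine ⟨x, ⟨Or.inl hxM, hxq⟩, ?_⟩
    rintro y ⟨hy | hy, hyq⟩
    exacts [hu y ⟨hy, hyq⟩, (hq y hy hyq).elim]

end IsTrimAt

theorem IsPPartition.exists_ne (hY : IsPPartition S Y) {p q : Q} (hpq : S.lt p q) {y : W}
    (hy : y ∈ Y p) {N : Set W} (hN : N ∈ 𝓝 y) : ∃ z ∈ N, z ∈ Y q ∧ z ≠ y := by
  have h : y ∈ derivedSet (Y q) ∩ ⋃ r, Y r := by
    rw [hY.2.2 q]
    exact Set.mem_biUnion (show p ∈ {r | S.lt r q} from hpq) hy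
  obtain ⟨z, hz, hne⟩ := accPt_iff_nhds.1 h.1 N hN
  exact ⟨z, hz.1, hz.2, hne⟩

theorem IsTrimAt.of_subset (hY : IsPPartition S Y) {F G : Set W} {p : Q}
    (hF : IsTrimAt S Y F p) (hG : IsCompactOpen G) (hGF : G ⊆ F) {y : W} (hyG : y ∈ G)
    (hy : y ∈ Y p) : IsTrimAt S Y G p := by
  refine ⟨hG.1, hG.2, ?_, fun hn => ?_⟩
  · ext q
    constructor
    · rintro ⟨z, hz, hzq⟩
      exact hF.le_of_mem (hGF hz) hzq
    · rintro (hq | rfl)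
      · obtain ⟨z, hz, hzq, -⟩ := hY.exists_ne hq hy (hG.2.mem_nhds hyG)
        exact ⟨z, hz, hzq⟩
      · exact ⟨y, hyG, hy⟩
  · refine ⟨y, ⟨hyG, hy⟩, fun z hz => ?_⟩
    exact (hF.2.2.2 hn).unique ⟨hGF hz.1, hz.2⟩ ⟨hGF hyG, hy⟩

theorem mem_Iw_of_le (hY : IsTrimPartition S Y) {p q : Q} {w : W} (hp : p ∈ Iw S Y w)
    (hqp : S.le q p) : q ∈ Iw S Y w := by
  by_cases hne : q = p
  · rwa [hne]
  obtain ⟨A, hA, hwA⟩ := hp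
  obtain ⟨z, hz⟩ := hY.1.1 q
  obtain ⟨M, hM, hzM⟩ := hY.2.2.2 q z hz
  refine ⟨M ∪ A, hM.union hA.isCompactOpen ?_ ?_, Or.inr hwA⟩
  · exact fun y hy r hr => S.le_trans hqp (hA.le_of_mem hy hr)
  · exact fun y hy hq => hne (S.le_antisymm hqp (hA.le_of_mem hy hq))

theorem Iw_eq_principalIdeal (hY : IsTrimPartition S Y) {p : Q} {w : W} (hw : w ∈ Y p) :
    Iw S Y w = S.principalIdeal p := by
  ext q
  constructor
  · rintro ⟨A, hA, hwA⟩
    exact hA.le_of_mem hwA hw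
  · exact fun h => mem_Iw_of_le hY (hY.2.2.2 p w hw) h

theorem isIdeal_Iw (hY : IsTrimPartition S Y) (w : W) : S.IsIdeal (Iw S Y w) := by
  refine ⟨?_, fun p hp q hqp => mem_Iw_of_le hY hp hqp, ?_⟩
  · obtain ⟨A, ⟨p, hA⟩, hwA, -⟩ := hY.2.1 w _ Filter.univ_mem
    exact ⟨p, A, hA, hwA⟩
  · rintro p ⟨A, hA, hwA⟩ q ⟨B, hB, hwB⟩
    obtain ⟨C, ⟨r, hC⟩, hwC, hCAB⟩ := hY.2.1 w _
      (Filter.inter_mem (hA.2.1.mem_nhds hwA) (hB.2.1.mem_nhds hwB))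
    obtain ⟨z, hz, hzr⟩ := hC.exists_mem S.le_rfl
    exact ⟨r, ⟨C, hC, hwC⟩, hA.le_of_mem (hCAB hz).1 hzr, hB.le_of_mem (hCAB hz).2 hzr⟩

/-- If `I_w` is the principal ideal of `p` then `w` lies in `Y p`. -/
theorem mem_of_Iw_eq_principalIdeal (hY : IsTrimPartition S Y) {p : Q} {w : W}
    (hw : Iw S Y w = S.principalIdeal p) : w ∈ Y p := by
  obtain ⟨A, hA, hwA⟩ : p ∈ Iw S Y w := by rw [hw]; exact S.le_rfl
  refine hY.2.2.1 p ⟨A, hA⟩ w fun U hU => ?_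
  obtain ⟨B, ⟨q, hB⟩, hwB, hBU⟩ := hY.2.1 w _ (Filter.inter_mem hU (hA.2.1.mem_nhds hwA))
  have h1 : S.le q p := by
    have : q ∈ Iw S Y w := ⟨B, hB, hwB⟩
    rwa [hw] at this
  obtain ⟨z, hz, hzq⟩ := hB.exists_mem S.le_rfl
  have h2 := hA.le_of_mem (hBU hz).2 hzq
  rw [S.le_antisymm h1 h2] at hB
  exact ⟨B, hB, hwB, hBU.trans Set.inter_subset_left⟩

variable [T2Space W] [LocallyCompactSpace W] [TotallyDisconnectedSpace W]

theorem exists_isTrimAt_subset (hY : IsTrimPartition S Y) {p : Q} {y : W} (hy : y ∈ Y p)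
    {N : Set W} (hN : N ∈ 𝓝 y) : ∃ A, IsTrimAt S Y A p ∧ y ∈ A ∧ A ⊆ N := by
  obtain ⟨B, hB, hyB⟩ := hY.2.2.2 p y hy
  obtain ⟨A, hA, hyA, hAN⟩ :=
    exists_isCompactOpen_subset (Filter.inter_mem hN (hB.2.1.mem_nhds hyB))
  exact ⟨A, hB.of_subset hY.1 hA (hAN.trans Set.inter_subset_right) hyA hy, hyA,
    hAN.trans Set.inter_subset_left⟩

theorem exists_isTrimAt_of_mem_Iw (hY : IsTrimPartition S Y) {q : Q} {x z : W} {O : Set W}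
    (hO : IsOpen O) (hxO : x ∈ O) (hq : q ∈ Iw S Y x) (hzO : z ∈ O) (hz : z ∈ Y q) :
    ∃ K, IsTrimAt S Y K q ∧ x ∈ K ∧ K ⊆ O := by
  obtain ⟨A, hA, hxA⟩ := hq
  obtain ⟨L, ⟨r, hL⟩, hxL, hLO⟩ := hY.2.1 x _
    (Filter.inter_mem (hO.mem_nhds hxO) (hA.2.1.mem_nhds hxA))
  by_cases hrq : r = q
  · exact ⟨L, hrq ▸ hL, hxL, hLO.trans Set.inter_subset_left⟩
  obtain ⟨M, hM, hzM, hMO⟩ := exists_isTrimAt_subset hY hz (hO.mem_nhds hzO)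
  refine ⟨M ∪ L, hM.union hL.isCompactOpen ?_ ?_, Or.inr hxL,
    Set.union_subset hMO (hLO.trans Set.inter_subset_left)⟩
  · exact fun y hy s hs => hA.le_of_mem (hLO hy).2 hs
  · intro y hy hyq
    obtain ⟨t, ht, htr⟩ := hL.exists_mem S.le_rfl
    exact hrq (S.le_antisymm (hL.le_of_mem hy hyq) (hA.le_of_mem (hLO ht).2 htr))

/-! ### Decomposition into trim sets -/

/-- Finite disjoint unions of trim sets. -/
inductive TrimUnion (S : POSystem Q) (Y : Q → Set W) : Set W → Prop
  | empty : TrimUnion S Y ∅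
  | add {U F : Set W} {p : Q} : TrimUnion S Y U → IsTrimAt S Y F p → Disjoint U F →
      TrimUnion S Y (U ∪ F)

namespace TrimUnion

theorem isCompactOpen {U : Set W} (h : TrimUnion S Y U) : IsCompactOpen U := by
  induction h with
  | empty => exact IsCompactOpen.empty
  | add _ hF _ ih => exact ih.union hF.isCompactOpen

theorem union_of_le {U D : Set W} (hU : TrimUnion S Y U) (hD : IsCompactOpen D)
    (hd : Disjoint U D) {p : Q} {y : W} (hyU : y ∈ U) (hy : y ∈ Y p)
    (hle : ∀ z ∈ D, ∀ r, z ∈ Y r → S.le p r) (hp : ∀ z ∈ D, z ∉ Y p) :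
    TrimUnion S Y (U ∪ D) := by
  induction hU with
  | empty => exact hyU.elim
  | @add U F q hU hF hUF ih =>
    rw [Set.disjoint_union_left] at hd
    rcases hyU with hyU | hyF
    · rw [Set.union_right_comm]
      exact (ih hd.1 hyU).add hF (Set.disjoint_union_left.2 ⟨hUF, hd.2.symm⟩)
    · rw [Set.union_assoc]
      have hqp := hF.le_of_mem hyF hy
      refine hU.add (hF.union hD (fun z hz r hr => S.le_trans hqp (hle z hz r hr)) ?_)
        (Set.disjoint_union_right.2 ⟨hUF, hd.1⟩)
      intro z hz hzq
      have := S.le_antisymm hqp (hle z hz q hzq)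
      exact hp z hz (this ▸ hzq)

theorem union_trim (hY : IsTrimPartition S Y) {U B : Set W} (hU : TrimUnion S Y U) {p : Q}
    (hB : IsTrimAt S Y B p) : TrimUnion S Y (U ∪ B) := by
  have hco := hB.isCompactOpen.diff hU.isCompactOpen
  rw [← Set.union_sdiff_self]
  by_cases h : ∃ y ∈ B \ U, y ∈ Y p
  · obtain ⟨y, hy, hyp⟩ := h
    exact hU.add (hB.of_subset hY.1 hco Set.sdiff_subset hy hyp) Set.disjoint_sdiff_right
  · push Not at h
    obtain ⟨y, hyB, hyp⟩ := hB.exists_mem S.le_rfl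
    have hyU : y ∈ U := by
      by_contra hyU
      exact h y ⟨hyB, hyU⟩ hyp
    exact hU.union_of_le hco Set.disjoint_sdiff_right hyU hyp
      (fun z hz r hr => hB.le_of_mem hz.1 hr) h

theorem union (hY : IsTrimPartition S Y) {U V : Set W} (hU : TrimUnion S Y U)
    (hV : TrimUnion S Y V) : TrimUnion S Y (U ∪ V) := by
  induction hV with
  | empty => rwa [Set.union_empty]
  | add _ hF _ ih =>
    rw [← Set.union_assoc]
    exact ih.union_trim hY hF

end TrimUnion

theorem IsCompactOpen.trimUnion (hY : IsTrimPartition S Y) {U : Set W} (hU : IsCompactOpen U) :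
    TrimUnion S Y U := by
  obtain ⟨t, hUt, htU, ht⟩ : ∃ t, U ⊆ t ∧ t ⊆ U ∧ TrimUnion S Y t := by
    refine hU.1.induction_on (p := fun s => ∃ t, s ⊆ t ∧ t ⊆ U ∧ TrimUnion S Y t)
      ⟨∅, subset_rfl, Set.empty_subset _, .empty⟩ ?_ ?_ ?_
    · rintro s s' hs ⟨t, ht, h⟩
      exact ⟨t, hs.trans ht, h⟩
    · rintro s s' ⟨t, hst, htU, ht⟩ ⟨t', hst', htU', ht'⟩
      exact ⟨t ∪ t', Set.union_subset_union hst hst', Set.union_subset htU htU', ht.union hY ht'⟩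
    · intro x hx
      obtain ⟨A, ⟨p, hA⟩, hxA, hAU⟩ := hY.2.1 x U (hU.2.mem_nhds hx)
      refine ⟨A, mem_nhdsWithin_of_mem_nhds (hA.2.1.mem_nhds hxA), A, subset_rfl, hAU, ?_⟩
      have := TrimUnion.empty.add hA (Set.empty_disjoint A)
      rwa [Set.empty_union] at this
  rwa [Set.Subset.antisymm hUt htU]

/-! ### Points with equal ideals lie in one orbit -/

/-- Compact open sets with matching decompositions into trim sets, where the pieces containing
the base points `w` and `x` correspond. -/
inductive TrimMatch (S : POSystem Q) (Y : Q → Set W) (w x : W) : Set W → Set W → Prop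
  | empty : TrimMatch S Y w x ∅ ∅
  | add {U V F G : Set W} {p : Q} : TrimMatch S Y w x U V → IsTrimAt S Y F p →
      IsTrimAt S Y G p → Disjoint U F → Disjoint V G → (w ∈ F ↔ x ∈ G) →
      TrimMatch S Y w x (U ∪ F) (V ∪ G)

namespace TrimMatch

variable {w x : W}

theorem symm {U V : Set W} (h : TrimMatch S Y w x U V) : TrimMatch S Y x w V U := by
  induction h with
  | empty => exact .empty
  | add _ hF hG hd hd' hwx ih => exact ih.add hG hF hd' hd hwx.symm

theorem isCompactOpen_left {U V : Set W} (h : TrimMatch S Y w x U V) : IsCompactOpen U := by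
  induction h with
  | empty => exact IsCompactOpen.empty
  | add _ hF _ _ _ _ ih => exact ih.union hF.isCompactOpen

theorem mem_iff {U V : Set W} (h : TrimMatch S Y w x U V) : w ∈ U ↔ x ∈ V := by
  induction h with
  | empty => simp
  | add _ _ _ _ _ hwx ih => simp [ih, hwx]

theorem nonempty {U V : Set W} (h : TrimMatch S Y w x U V) (hU : U.Nonempty) : V.Nonempty := by
  cases h with
  | empty => exact hU
  | add _ _ hG _ _ _ =>
    obtain ⟨z, hz, -⟩ := hG.exists_mem S.le_rfl
    exact ⟨z, Or.inr hz⟩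

theorem of_trim {F G : Set W} {p : Q} (hF : IsTrimAt S Y F p) (hG : IsTrimAt S Y G p)
    (h : w ∈ F ↔ x ∈ G) : TrimMatch S Y w x F G := by
  have := TrimMatch.empty.add hF hG (Set.empty_disjoint F) (Set.empty_disjoint G) h
  rwa [Set.empty_union, Set.empty_union] at this

theorem union {U V U' V' : Set W} (h : TrimMatch S Y w x U V) (h' : TrimMatch S Y w x U' V')
    (hU : Disjoint U U') (hV : Disjoint V V') : TrimMatch S Y w x (U ∪ U') (V ∪ V') := by
  induction h' with
  | empty => simpa using h
  | add _ hF hG hd hd' hwx ih =>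
    rw [Set.disjoint_union_right] at hU hV
    rw [← Set.union_assoc, ← Set.union_assoc]
    exact (ih hU.1 hV.1).add hF hG (Set.disjoint_union_left.2 ⟨hU.2, hd⟩)
      (Set.disjoint_union_left.2 ⟨hV.2, hd'⟩) hwx

/-- A set of types above `p` has a matching set in every neighbourhood of a point of `Y p`. -/
theorem exists_of_lt (hY : IsTrimPartition S Y) {p : Q} {y : W} (hy : y ∈ Y p) {U : Set W}
    (hU : TrimUnion S Y U) (hlt : ∀ z ∈ U, ∀ q, z ∈ Y q → S.lt p q) (hw : w ∉ U) {N : Set W}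
    (hN : IsOpen N) (hyN : y ∈ N) : ∃ V ⊆ N, y ∉ V ∧ x ∉ V ∧ TrimMatch S Y w x U V := by
  induction hU with
  | empty => exact ⟨∅, Set.empty_subset _, fun h => h, fun h => h, .empty⟩
  | @add U F q hU hF hd ih =>
    obtain ⟨V, hVN, hyV, hxV, hV⟩ := ih (fun z hz => hlt z (Or.inl hz)) fun h => hw (Or.inl h)
    obtain ⟨t, ht, htq⟩ := hF.exists_mem S.le_rfl
    have hpq := hlt t (Or.inr ht) q htq
    have hVc := hV.symm.isCompactOpen_left.isClosed
    have hopen : IsOpen (N \ (V ∪ ({x} \ {y}))) := hN.sdiff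
      (hVc.union ((Set.finite_singleton x).subset Set.sdiff_subset).isClosed)
    have hymem : y ∈ N \ (V ∪ ({x} \ {y})) := ⟨hyN, by simp [hyV]⟩
    obtain ⟨z, hz, hzq, hzy⟩ := hY.1.exists_ne hpq hy (hopen.mem_nhds hymem)
    have hopen' : IsOpen ((N \ (V ∪ ({x} \ {y}))) \ {y}) := hopen.sdiff isClosed_singleton
    obtain ⟨G, hG, hzG, hGN⟩ := exists_isTrimAt_subset hY hzq (hopen'.mem_nhds ⟨hz, hzy⟩)
    have hyG : y ∉ G := fun h => (hGN h).2 rfl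
    have hxG : x ∉ G := by
      intro h
      by_cases hxy : x = y
      · exact hyG (hxy ▸ h)
      · exact (hGN h).1.2 (Or.inr ⟨rfl, hxy⟩)
    refine ⟨V ∪ G, Set.union_subset hVN fun z hz => (hGN hz).1.1, ?_, ?_,
      hV.add hF hG hd ?_ ?_⟩
    · exact fun h => h.elim hyV hyG
    · exact fun h => h.elim hxV hxG
    · exact Set.disjoint_right.2 fun z hz hzV => (hGN hz).1.2 (Or.inl hzV)
    · exact ⟨fun h => (hw (Or.inr h)).elim, fun h => (hxG h).elim⟩

theorem exists_complement (hY : IsTrimPartition S Y) (hwx : Iw S Y w = Iw S Y x) {F G F₂ : Set W}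
    {p : Q} (hG : IsTrimAt S Y G p) (hwF : w ∈ F → x ∈ G)
    (hF₂F : F₂ ⊆ F) (hF₂ : IsCompactOpen F₂) (hlt : ∀ z ∈ F₂, ∀ q, z ∈ Y q → S.lt p q) :
    ∃ G₂ ⊆ G, TrimMatch S Y w x F₂ G₂ ∧ ∃ y ∈ G \ G₂, y ∈ Y p := by
  obtain ⟨y, hyG, hy⟩ := hG.exists_mem S.le_rfl
  by_cases hw : w ∈ F₂
  · have hxG := hwF (hF₂F hw)
    obtain ⟨H, ⟨q, hH⟩, hwH, hHF⟩ := hY.2.1 w F₂ (hF₂.2.mem_nhds hw)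
    obtain ⟨t, ht, htq⟩ := hH.exists_mem S.le_rfl
    have hpq := hlt t (hHF ht) q htq
    have hqx : q ∈ Iw S Y x := hwx ▸ ⟨H, hH, hwH⟩
    obtain ⟨y, hyG, hy, hyx⟩ : ∃ y ∈ G, y ∈ Y p ∧ y ≠ x := by
      by_cases hyx : y = x
      · subst hyx
        have hqp : S.le q p := by rwa [Iw_eq_principalIdeal hY hy] at hqx
        exact hY.1.exists_ne (S.lt_self_of_lt_of_le hpq hqp) hy (hG.2.1.mem_nhds hyG)
      · exact ⟨y, hyG, hy, hyx⟩
    obtain ⟨z, hzG, hzq, hzy⟩ := hY.1.exists_ne hpq hy (hG.2.1.mem_nhds hyG)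
    obtain ⟨K, hK, hxK, hKG⟩ := exists_isTrimAt_of_mem_Iw hY
      (hG.2.1.sdiff (isClosed_singleton (x := y))) ⟨hxG, hyx.symm⟩ hqx ⟨hzG, hzy⟩ hzq
    have hyK : y ∉ K := fun h => (hKG h).2 rfl
    obtain ⟨V, hVG, hyV, -, hV⟩ := exists_of_lt (w := w) (x := x) hY hy
      ((hF₂.diff hH.isCompactOpen).trimUnion hY) (fun z hz => hlt z hz.1) (fun h => h.2 hwH)
      (hG.2.1.sdiff hK.isCompactOpen.isClosed) ⟨hyG, hyK⟩
    refine ⟨V ∪ K, ?_, ?_, y, ⟨hyG, fun h => h.elim hyV hyK⟩, hy⟩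
    · exact Set.union_subset (hVG.trans Set.sdiff_subset) (hKG.trans Set.sdiff_subset)
    · have := hV.add hH hK Set.disjoint_sdiff_left
        (Set.disjoint_left.2 fun z hz => (hVG hz).2) ⟨fun _ => hxK, fun _ => hwH⟩
      rwa [Set.sdiff_union_of_subset hHF] at this
  · obtain ⟨V, hVG, hyV, -, hV⟩ := exists_of_lt (w := w) (x := x) hY hy (hF₂.trimUnion hY) hlt hw
      hG.2.1 hyG
    exact ⟨V, hVG, hV, y, ⟨hyG, hyV⟩, hy⟩

theorem split_trim (hY : IsTrimPartition S Y) (hwx : Iw S Y w = Iw S Y x) {F G F₁ : Set W}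
    {p : Q} (hF : IsTrimAt S Y F p) (hG : IsTrimAt S Y G p) (hwF : w ∈ F ↔ x ∈ G)
    (hF₁F : F₁ ⊆ F) (hF₁ : IsCompactOpen F₁) :
    ∃ G₁ ⊆ G, TrimMatch S Y w x F₁ G₁ ∧ TrimMatch S Y w x (F \ F₁) (G \ G₁) := by
  have key : ∀ F₁ ⊆ F, IsCompactOpen F₁ → (∃ y ∈ F₁, y ∈ Y p) →
      ∃ G₂ ⊆ G, TrimMatch S Y w x (F \ F₁) G₂ ∧ TrimMatch S Y w x F₁ (G \ G₂) := by
    rintro F₁ hF₁F hF₁ ⟨y, hyF₁, hy⟩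
    have hlt : ∀ z ∈ F \ F₁, ∀ q, z ∈ Y q → S.lt p q := by
      intro z hz q hzq
      rcases hF.le_of_mem hz.1 hzq with h | rfl
      · exact h
      · refine hF.lt_self_of_ne hz.1 (hF₁F hyF₁) hzq hy ?_
        rintro rfl
        exact hz.2 hyF₁
    obtain ⟨G₂, hG₂, hm, y', hy', hyp'⟩ := exists_complement hY hwx hG hwF.1 Set.sdiff_subset
      (hF.isCompactOpen.diff hF₁) hlt
    refine ⟨G₂, hG₂, hm, of_trim (hF.of_subset hY.1 hF₁ hF₁F hyF₁ hy) (hG.of_subset hY.1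
      (hG.isCompactOpen.diff hm.symm.isCompactOpen_left) Set.sdiff_subset hy' hyp') ?_⟩
    have h1 := hm.mem_iff
    simp only [Set.mem_sdiff] at h1 ⊢
    constructor
    · intro h
      exact ⟨hwF.1 (hF₁F h), fun hx => (h1.2 hx).2 h⟩
    · rintro ⟨h, h'⟩
      by_contra hn
      exact h' (h1.1 ⟨hwF.2 h, hn⟩)
  by_cases h : ∃ y ∈ F₁, y ∈ Y p
  · obtain ⟨G₂, hG₂, h1, h2⟩ := key F₁ hF₁F hF₁ h
    exact ⟨G \ G₂, Set.sdiff_subset, h2, by rwa [Set.sdiff_sdiff_cancel_left hG₂]⟩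
  · obtain ⟨y, hyF, hy⟩ := hF.exists_mem S.le_rfl
    obtain ⟨G₂, hG₂, h1, h2⟩ := key (F \ F₁) Set.sdiff_subset (hF.isCompactOpen.diff hF₁)
      ⟨y, ⟨hyF, fun h' => h ⟨y, h', hy⟩⟩, hy⟩
    rw [Set.sdiff_sdiff_cancel_left hF₁F] at h1
    exact ⟨G₂, hG₂, h1, h2⟩

theorem forth (hY : IsTrimPartition S Y) (hwx : Iw S Y w = Iw S Y x) {U V : Set W}
    (h : TrimMatch S Y w x U V) : ∀ U₁ ⊆ U, IsCompactOpen U₁ →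
      ∃ V₁ ⊆ V, TrimMatch S Y w x U₁ V₁ ∧ TrimMatch S Y w x (U \ U₁) (V \ V₁) := by
  induction h with
  | empty =>
    intro U₁ hU₁ _
    rw [Set.subset_empty_iff] at hU₁
    subst hU₁
    exact ⟨∅, subset_rfl, .empty, by simpa using TrimMatch.empty⟩
  | @add U V F G p hUV hF hG hd hd' hiff ih =>
    intro A hA hAc
    obtain ⟨V₁, hV₁, h1, h2⟩ := ih (A ∩ U) Set.inter_subset_right
      (hAc.inter hUV.isCompactOpen_left)
    obtain ⟨G₁, hG₁, h3, h4⟩ := split_trim hY hwx hF hG hiff (F₁ := A ∩ F)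
      Set.inter_subset_right (hAc.inter hF.isCompactOpen)
    refine ⟨V₁ ∪ G₁, Set.union_subset_union hV₁ hG₁, ?_, ?_⟩
    · have := h1.union h3 (hd.mono Set.inter_subset_right Set.inter_subset_right)
        (hd'.mono hV₁ hG₁)
      rwa [← Set.inter_union_distrib_left, Set.inter_eq_self_of_subset_left hA] at this
    · have := h2.union h4 (hd.mono Set.sdiff_subset Set.sdiff_subset)
        (hd'.mono Set.sdiff_subset Set.sdiff_subset)
      have e1 : (U ∪ F) \ A = U \ (A ∩ U) ∪ F \ (A ∩ F) := by
        ext z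
        simp only [Set.mem_sdiff, Set.mem_union, Set.mem_inter_iff]
        tauto
      have e2 : (V ∪ G) \ (V₁ ∪ G₁) = V \ V₁ ∪ G \ G₁ := by
        ext z
        have hz1 : z ∈ V → z ∉ G := fun h => Set.disjoint_left.1 hd' h
        have hz2 := @hV₁ z
        have hz3 := @hG₁ z
        simp only [Set.mem_sdiff, Set.mem_union]
        tauto
      rwa [e1, e2]

theorem backForth (hY : IsTrimPartition S Y) (hwx : Iw S Y w = Iw S Y x) :
    BackForth (TrimMatch S Y w x) where
  left h := h.isCompactOpen_left
  right h := h.symm.isCompactOpen_left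
  nonempty_iff h := ⟨h.nonempty, h.symm.nonempty⟩
  forth h := h.forth hY hwx
  back h V₁ hV₁ hc :=
    let ⟨U₁, hU₁, h1, h2⟩ := h.symm.forth hY hwx.symm V₁ hV₁ hc
    ⟨U₁, hU₁, h1.symm, h2.symm⟩

end TrimMatch

end Trim

section Orbit

variable {W : Type*} [TopologicalSpace W]

/-- A homeomorphism of a clopen subset extends to the whole space by the identity. -/
theorem exists_homeomorph_extend {A : Set W} (hA : IsClopen A) (h : A ≃ₜ A) :
    ∃ g : W ≃ₜ W, ∀ a : A, g a = h a := by
  classical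
  let f : (A ≃ₜ A) → W → W := fun h z => if hz : z ∈ A then (h ⟨z, hz⟩ : W) else z
  have hc : ∀ h, Continuous (f h) := by
    intro h
    rw [← continuousOn_univ, ← Set.union_compl_self A]
    refine ContinuousOn.union_of_isOpen ?_ ?_ hA.2 hA.compl.2
    · rw [continuousOn_iff_continuous_domRestrict]
      refine (continuous_subtype_val.comp h.continuous).congr fun z => ?_
      simp [f]
    · exact continuousOn_id.congr fun z hz => dif_neg hz
  have hinv : ∀ h, Function.LeftInverse (f h.symm) (f h) := by
    intro h z
    by_cases hz : z ∈ A <;> simp [f, hz]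
  refine ⟨⟨⟨f h, f h.symm, hinv h, hinv h.symm⟩, hc h, hc h.symm⟩, fun a => ?_⟩
  exact dif_pos a.2

variable {Q : Type*} {S : POSystem Q} {Y : Q → Set W}
variable [T2Space W] [LocallyCompactSpace W] [TotallyDisconnectedSpace W]

theorem exists_trimMatch_self (hY : IsTrimPartition S Y) {w x : W} (hwx : Iw S Y w = Iw S Y x) :
    ∃ U, w ∈ U ∧ TrimMatch S Y w x U U := by
  obtain ⟨A, ⟨p, hA⟩, hwA, -⟩ := hY.2.1 w _ Filter.univ_mem
  by_cases hxA : x ∈ A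
  · exact ⟨A, hwA, .of_trim hA hA ⟨fun _ => hxA, fun _ => hwA⟩⟩
  obtain ⟨B, hB, hxB⟩ : p ∈ Iw S Y x := hwx ▸ ⟨A, hA, hwA⟩
  obtain ⟨C, ⟨q, hC⟩, hxC, hCB⟩ := hY.2.1 x _
    ((hB.2.1.sdiff hA.isCompactOpen.isClosed).mem_nhds ⟨hxB, hxA⟩)
  have hd : Disjoint A C := Set.disjoint_right.2 fun z hz => (hCB hz).2
  by_cases hqp : q = p
  · subst hqp
    have h := TrimMatch.union (.of_trim (w := w) (x := x) hA hC ⟨fun _ => hxC, fun _ => hwA⟩)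
      (.of_trim hC hA ⟨fun h => (Set.disjoint_left.1 hd hwA h).elim, fun h => (hxA h).elim⟩)
      hd hd.symm
    rw [Set.union_comm C A] at h
    exact ⟨A ∪ C, Or.inl hwA, h⟩
  · have hle : ∀ z ∈ C, ∀ r, z ∈ Y r → S.le p r := fun z hz r hr => hB.le_of_mem (hCB hz).1 hr
    have hAC : IsTrimAt S Y (A ∪ C) p := hA.union hC.isCompactOpen hle fun z hz hzp => by
      obtain ⟨t, ht, htq⟩ := hC.exists_mem S.le_rfl
      exact hqp (S.le_antisymm (hC.le_of_mem hz hzp) (hle t ht q htq))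
    exact ⟨A ∪ C, Or.inl hwA, .of_trim hAC hAC ⟨fun _ => Or.inr hxC, fun _ => Or.inl hwA⟩⟩

variable [SecondCountableTopology W]

/-- Points with the same ideal of trim types lie in the same orbit. -/
theorem exists_homeomorph_of_Iw_eq (hY : IsTrimPartition S Y) {w x : W}
    (hwx : Iw S Y w = Iw S Y x) : ∃ g : W ≃ₜ W, g w = x := by
  obtain ⟨U, hwU, hU⟩ := exists_trimMatch_self hY hwx
  obtain ⟨h, hh⟩ := (TrimMatch.backForth hY hwx).exists_homeomorph hU
  have hUc := hU.isCompactOpen_left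
  obtain ⟨g, hg⟩ := exists_homeomorph_extend ⟨hUc.isClosed, hUc.2⟩ h
  refine ⟨g, (hg ⟨w, hwU⟩).trans ?_⟩
  by_contra hne
  obtain ⟨U', V', hm, hw, hV⟩ := hh ⟨w, hwU⟩ {x}ᶜ (isOpen_compl_singleton.mem_nhds hne)
  exact hV (hm.mem_iff.1 hw) rfl

/-! ### The ideal completion of a trim partition -/

theorem IsTrimPartition.countable (hY : IsTrimPartition S Y) : Countable Q := by
  obtain ⟨C, hC, hCb⟩ := exists_seq_isCompactOpen (W := W)
  have key : ∀ p, ∃ n, IsTrimAt S Y (C n) p := by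
    intro p
    obtain ⟨y, hy⟩ := hY.1.1 p
    obtain ⟨A, hA, hyA⟩ := hY.2.2.2 p y hy
    obtain ⟨n, hn, hnA⟩ := hCb y A (hA.2.1.mem_nhds hyA)
    exact ⟨n, hA.of_subset hY.1 (hC n) hnA hn hy⟩
  choose f hf using key
  refine Function.Injective.countable (f := f) fun p q hpq => ?_
  have h := hf p
  rw [hpq] at h
  exact h.eq (hf q)

/-- Each trim set whose type lies in the ideal `K` contains a point `x` with `I_x = K`. -/
theorem IsTrimAt.exists_Iw_eq (hY : IsTrimPartition S Y) {A : Set W} {p : Q}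
    (hA : IsTrimAt S Y A p) {K : Set Q} (hK : S.IsIdeal K) (hpK : p ∈ K) :
    ∃ x ∈ A, Iw S Y x = K := by
  obtain ⟨C, hC, hCb⟩ := exists_seq_isCompactOpen (W := W)
  have := hY.countable
  have : Nonempty K := ⟨⟨p, hpK⟩⟩
  obtain ⟨q, hq⟩ := exists_surjective_nat K
  have step : ∀ (n : ℕ) (a : {a : Set W × Q // IsTrimAt S Y a.1 a.2 ∧ a.2 ∈ K}),
      ∃ b : {a : Set W × Q // IsTrimAt S Y a.1 a.2 ∧ a.2 ∈ K},
        b.1.1 ⊆ a.1.1 ∧ S.le (q n).1 b.1.2 ∧ (b.1.1 ⊆ C n ∨ Disjoint b.1.1 (C n)) := by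
    rintro n ⟨⟨B, r⟩, hB, hr⟩
    obtain ⟨s, hs, hrs, hqs⟩ := hK.2.2 r hr _ (q n).2
    obtain ⟨z, hzB, hzs⟩ := hB.exists_mem hrs
    by_cases hzC : z ∈ C n
    · obtain ⟨D, hD, -, hDB⟩ := exists_isTrimAt_subset hY hzs
        ((hB.2.1.inter (hC n).2).mem_nhds ⟨hzB, hzC⟩)
      exact ⟨⟨(D, s), hD, hs⟩, hDB.trans Set.inter_subset_left, hqs,
        Or.inl (hDB.trans Set.inter_subset_right)⟩
    · obtain ⟨D, hD, -, hDB⟩ := exists_isTrimAt_subset hY hzs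
        ((hB.2.1.sdiff (hC n).isClosed).mem_nhds ⟨hzB, hzC⟩)
      exact ⟨⟨(D, s), hD, hs⟩, hDB.trans Set.sdiff_subset, hqs,
        Or.inr (Set.disjoint_left.2 fun z hz => (hDB hz).2)⟩
  choose next hn1 hn2 hn3 using step
  let a : ℕ → {a : Set W × Q // IsTrimAt S Y a.1 a.2 ∧ a.2 ∈ K} :=
    fun n => Nat.rec ⟨(A, p), hA, hpK⟩ (fun k b => next k b) n
  obtain ⟨x, hx⟩ := IsCompact.nonempty_iInter_of_sequence_nonempty_isCompact_isClosed
    (fun n => (a n).1.1) (fun n => hn1 n (a n))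
    (fun n => let ⟨z, hz, _⟩ := (a n).2.1.exists_mem S.le_rfl; ⟨z, hz⟩) hA.1
    (fun n => (a n).2.1.isCompactOpen.isClosed)
  rw [Set.mem_iInter] at hx
  refine ⟨x, hx 0, ?_⟩
  ext s
  constructor
  · rintro ⟨B, hB, hxB⟩
    obtain ⟨n, hxn, hnB⟩ := hCb x B (hB.2.1.mem_nhds hxB)
    have hsub : (a (n + 1)).1.1 ⊆ C n := by
      rcases hn3 n (a n) with h | h
      · exact h
      · exact (Set.disjoint_left.1 h (hx (n + 1)) hxn).elim
    obtain ⟨z, hz, hzr⟩ := (a (n + 1)).2.1.exists_mem S.le_rfl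
    exact hK.2.1 _ (a (n + 1)).2.2 _ (hB.le_of_mem (hnB (hsub hz)) hzr)
  · intro hs
    obtain ⟨n, hn⟩ := hq ⟨s, hs⟩
    have h := hn2 n (a n)
    rw [hn] at h
    exact mem_Iw_of_le hY ⟨_, (a (n + 1)).2.1, hx (n + 1)⟩ h

/-- The ideal `I_w` as an element of the ideal completion. -/
def idealAt (hY : IsTrimPartition S Y) (w : W) : Idl S := ⟨Iw S Y w, isIdeal_Iw hY w⟩

theorem mem_idBlock_iff (hY : IsTrimPartition S Y) {w : W} {J : Idl S} :
    w ∈ idBlock S Y J ↔ idealAt hY w = J :=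
  ⟨fun h => Subtype.ext h, fun h => congrArg Subtype.val h⟩

theorem idBlock_nonempty (hY : IsTrimPartition S Y) (J : Idl S) : (idBlock S Y J).Nonempty := by
  obtain ⟨p, hp⟩ := J.2.1
  obtain ⟨y, hy⟩ := hY.1.1 p
  obtain ⟨A, hA, -⟩ := hY.2.2.2 p y hy
  obtain ⟨x, -, hx⟩ := hA.exists_Iw_eq hY J.2 hp
  exact ⟨x, hx⟩

theorem mem_derivedSet_idBlock_iff (hY : IsTrimPartition S Y) {w : W} {K : Idl S} :
    w ∈ derivedSet (idBlock S Y K) ↔ (idPO S).lt (idealAt hY w) K := by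
  rw [mem_derivedSet, accPt_iff_nhds]
  constructor
  · intro h
    have hsub : (idealAt hY w).1 ⊆ K.1 := by
      rintro p ⟨A, hA, hwA⟩
      obtain ⟨x, ⟨hxA, hx⟩, -⟩ := h A (hA.2.1.mem_nhds hwA)
      rw [← show Iw S Y x = K.1 from hx]
      exact ⟨A, hA, hxA⟩
    by_cases hJK : idealAt hY w = K
    · refine Or.inr ⟨hJK, ?_⟩
      rintro ⟨p, hpp, hp⟩
      have hwp := mem_of_Iw_eq_principalIdeal hY hp
      obtain ⟨A, hA, hwA⟩ := hY.2.2.2 p w hwp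
      obtain ⟨x, ⟨hxA, hx⟩, hne⟩ := h A (hA.2.1.mem_nhds hwA)
      have hx' : Iw S Y x = S.principalIdeal p :=
        (show Iw S Y x = K.1 from hx).trans (hJK ▸ hp)
      exact hpp (hA.lt_self_of_ne hxA hwA (mem_of_Iw_eq_principalIdeal hY hx') hwp hne)
    · exact Or.inl ⟨hsub, hJK⟩
  · intro h U hU
    obtain ⟨A, ⟨p, hA⟩, hwA, hAU⟩ := hY.2.1 w U hU
    have hpw : p ∈ Iw S Y w := ⟨A, hA, hwA⟩
    rcases h with ⟨hsub, hne⟩ | ⟨rfl, hn⟩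
    · obtain ⟨x, hxA, hx⟩ := hA.exists_Iw_eq hY K.2 (hsub hpw)
      refine ⟨x, ⟨hAU hxA, hx⟩, ?_⟩
      rintro rfl
      exact hne (Subtype.ext hx)
    · obtain ⟨y, hyA, hyp, hyw⟩ : ∃ y ∈ A, y ∈ Y p ∧ y ≠ w := by
        by_cases hwp : w ∈ Y p
        · have hpp : S.lt p p := by
            by_contra hpp
            exact hn ⟨p, hpp, Iw_eq_principalIdeal hY hwp⟩
          exact hY.1.exists_ne hpp hwp (hA.2.1.mem_nhds hwA)
        · obtain ⟨y, hyA, hyp⟩ := hA.exists_mem S.le_rfl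
          refine ⟨y, hyA, hyp, ?_⟩
          rintro rfl
          exact hwp hyp
      obtain ⟨B, hB, -, hBA⟩ := exists_isTrimAt_subset hY hyp
        ((hA.2.1.sdiff (isClosed_singleton (x := w))).mem_nhds ⟨hyA, hyw⟩)
      obtain ⟨x, hxB, hx⟩ := hB.exists_Iw_eq hY (isIdeal_Iw hY w) hpw
      exact ⟨x, ⟨hAU (hBA hxB).1, hx⟩, (hBA hxB).2⟩

theorem isPPartition_idBlock (hY : IsTrimPartition S Y) :
    IsPPartition (idPO S) (idBlock S Y) := by
  refine ⟨idBlock_nonempty hY, fun J K hJK => ?_, fun K => ?_⟩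
  · exact Set.disjoint_left.2 fun w hJ hK =>
      hJK (((mem_idBlock_iff hY).1 hJ).symm.trans ((mem_idBlock_iff hY).1 hK))
  · ext w
    simp only [Set.mem_inter_iff, Set.mem_iUnion, Set.mem_ofPred_eq, exists_prop,
      mem_derivedSet_idBlock_iff hY, mem_idBlock_iff hY]
    constructor
    · rintro ⟨h, -⟩
      exact ⟨_, h, rfl⟩
    · rintro ⟨J, h, rfl⟩
      exact ⟨h, _, rfl⟩

theorem IsTrimAt.idBlock (hY : IsTrimPartition S Y) {A : Set W} {p : Q}
    (hA : IsTrimAt S Y A p) : IsTrimAt (idPO S) (idBlock S Y) A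
      ⟨S.principalIdeal p, S.isIdeal_principalIdeal p⟩ := by
  refine ⟨hA.1, hA.2.1, ?_, fun hn => ?_⟩
  · ext J
    constructor
    · rintro ⟨w, hwA, hw⟩
      have hpJ : p ∈ J.1 := by
        rw [← show Iw S Y w = J.1 from hw]
        exact ⟨A, hA, hwA⟩
      by_cases h : ⟨S.principalIdeal p, S.isIdeal_principalIdeal p⟩ = J
      · exact Or.inr h
      · exact Or.inl (Or.inl ⟨fun q hq => J.2.2.1 p hpJ q hq, h⟩)
    · intro h
      have hpJ : p ∈ J.1 := by
        rcases h with (⟨h, -⟩ | ⟨rfl, -⟩) | rfl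
        exacts [h S.le_rfl, S.le_rfl, S.le_rfl]
      obtain ⟨x, hxA, hx⟩ := hA.exists_Iw_eq hY J.2 hpJ
      exact ⟨x, hxA, hx⟩
  · have hpp : ¬ S.lt p p := by
      intro hpp
      refine hn (Or.inr ⟨rfl, ?_⟩)
      rintro ⟨q, hqq, hq⟩
      exact hqq (S.principalIdeal_injective hq ▸ hpp)
    obtain ⟨x, ⟨hxA, hx⟩, hu⟩ := hA.2.2.2 hpp
    refine ⟨x, ⟨hxA, Iw_eq_principalIdeal hY hx⟩, fun y hy => hu y ⟨hy.1, ?_⟩⟩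
    exact mem_of_Iw_eq_principalIdeal hY hy.2

theorem hasTrimBases_idBlock (hY : IsTrimPartition S Y) :
    HasTrimBases (idPO S) (idBlock S Y) := by
  intro w U hU
  obtain ⟨A, ⟨p, hA⟩, hwA, hAU⟩ := hY.2.1 w U hU
  exact ⟨A, ⟨_, hA.idBlock hY⟩, hwA, hAU⟩

end Orbit

/-! ### Transport of partitions along a bijection of index sets -/

section Transport

variable {W : Type*} [TopologicalSpace W] {P Q : Type*} {S : POSystem P} {T : POSystem Q}
  {X : P → Set W} {Z : Q → Set W}

theorem IsPPartition.of_equiv (e : P ≃ Q) (hXZ : ∀ p, X p = Z (e p))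
    (hlt : ∀ p q, S.lt p q ↔ T.lt (e p) (e q)) (hX : IsPPartition S X) : IsPPartition T Z := by
  have hZ : ∀ q, Z q = X (e.symm q) := fun q => by simp [hXZ]
  refine ⟨fun q => ?_, fun q r hqr => ?_, fun q => ?_⟩
  · rw [hZ]; exact hX.1 _
  · simp only [hZ]
    exact hX.2.1 (e.symm.injective.ne hqr)
  · have h := hX.2.2 (e.symm q)
    have e1 : (⋃ r, Z r) = ⋃ p, X p := by
      simp only [hXZ]
      exact (e.surjective.iUnion_comp Z).symm
    rw [hZ, e1, h]
    ext w
    simp only [Set.mem_iUnion, Set.mem_ofPred_eq, exists_prop, hlt, hXZ]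
    constructor
    · rintro ⟨p, h1, h2⟩
      exact ⟨e p, by simpa using h1, h2⟩
    · rintro ⟨r, h1, h2⟩
      exact ⟨e.symm r, by simpa using h1, by simpa using h2⟩

theorem IsTrimAt.of_equiv (e : P ≃ Q) (hXZ : ∀ p, X p = Z (e p))
    (hlt : ∀ p q, S.lt p q ↔ T.lt (e p) (e q)) {A : Set W} {p : P} (hA : IsTrimAt S X A p) :
    IsTrimAt T Z A (e p) := by
  refine ⟨hA.1, hA.2.1, ?_, fun hn => ?_⟩
  · ext q
    obtain ⟨q, rfl⟩ := e.surjective q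
    have h : q ∈ ptype X A ↔ S.le p q := by rw [hA.2.2.1]; rfl
    change (A ∩ Z (e q)).Nonempty ↔ (T.lt (e p) (e q) ∨ e p = e q)
    rw [← hXZ, ← hlt, e.injective.eq_iff]
    exact h
  · rw [← hXZ]
    exact hA.2.2.2 fun h => hn ((hlt _ _).1 h)

theorem HasTrimBases.of_equiv (e : P ≃ Q) (hXZ : ∀ p, X p = Z (e p))
    (hlt : ∀ p q, S.lt p q ↔ T.lt (e p) (e q)) (hX : HasTrimBases S X) : HasTrimBases T Z := by
  intro w U hU
  obtain ⟨A, ⟨p, hA⟩, h⟩ := hX w U hU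
  exact ⟨A, ⟨_, hA.of_equiv e hXZ hlt⟩, h⟩

end Transport

/-! ### The orbit diagram -/

section OrbitDiagram

variable {W : Type*} [TopologicalSpace W]

theorem homeoOrbit_eq_of_mem {w x : W} (h : x ∈ homeoOrbit w) : homeoOrbit x = homeoOrbit w := by
  obtain ⟨g, rfl⟩ := h
  ext z
  constructor
  · rintro ⟨f, rfl⟩
    exact ⟨g.trans f, rfl⟩
  · rintro ⟨f, rfl⟩
    exact ⟨g.symm.trans f, by simp⟩

theorem Orbits.eq_homeoOrbit {O : Orbits W} {w : W} (h : w ∈ O.1) : O.1 = homeoOrbit w := by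
  obtain ⟨x, hx⟩ := O.2
  rw [hx] at h ⊢
  exact (homeoOrbit_eq_of_mem h).symm

variable [T2Space W]

theorem image_mem_canonicalBlock (g : W ≃ₜ W) {p : SDiagram W} {w : W}
    (hw : w ∈ canonicalBlock p) : g w ∈ canonicalBlock p := by
  refine mem_canonicalBlock.2 fun U hU => ?_
  obtain ⟨A, hA, rfl, hwA, hAU⟩ := mem_canonicalBlock.1 hw _ (g.continuous.continuousAt hU)
  have hiso := idealIso_image g A
  have hPI := hA.of_idealIso ⟨hA.2.1.image g.continuous, g.isOpenMap _ hA.2.2.1⟩ hiso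
  exact ⟨g '' A, hPI, piClass_eq_iff.2 hiso.symm, Set.mem_image_of_mem g hwA,
    Set.image_subset_iff.2 hAU⟩

theorem image_mem_canonicalBlock_iff (g : W ≃ₜ W) {p : SDiagram W} {w : W} :
    g w ∈ canonicalBlock p ↔ w ∈ canonicalBlock p := by
  refine ⟨fun h => ?_, image_mem_canonicalBlock g⟩
  simpa using image_mem_canonicalBlock g.symm h

theorem IsTrimAt.image_canonicalBlock (g : W ≃ₜ W) {A : Set W} {p : SDiagram W}
    (hA : IsTrimAt (SDiagramPO W) canonicalBlock A p) :
    IsTrimAt (SDiagramPO W) canonicalBlock (g '' A) p := by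
  refine ⟨hA.1.image g.continuous, g.isOpenMap _ hA.2.1, ?_, fun hn => ?_⟩
  · rw [← hA.2.2.1]
    ext q
    constructor
    · rintro ⟨_, ⟨z, hz, rfl⟩, hzq⟩
      exact ⟨z, hz, (image_mem_canonicalBlock_iff g).1 hzq⟩
    · rintro ⟨z, hz, hzq⟩
      exact ⟨g z, Set.mem_image_of_mem g hz, (image_mem_canonicalBlock_iff g).2 hzq⟩
  · obtain ⟨x, ⟨hxA, hx⟩, hu⟩ := hA.2.2.2 hn
    refine ⟨g x, ⟨Set.mem_image_of_mem g hxA, (image_mem_canonicalBlock_iff g).2 hx⟩, ?_⟩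
    rintro _ ⟨⟨y, hy, rfl⟩, hyp⟩
    rw [hu y ⟨hy, (image_mem_canonicalBlock_iff g).1 hyp⟩]

theorem Iw_canonicalBlock_subset (g : W ≃ₜ W) (w : W) :
    Iw (SDiagramPO W) canonicalBlock w ⊆ Iw (SDiagramPO W) canonicalBlock (g w) := by
  rintro p ⟨A, hA, hwA⟩
  exact ⟨g '' A, hA.image_canonicalBlock g, Set.mem_image_of_mem g hwA⟩

theorem Iw_canonicalBlock_homeomorph (g : W ≃ₜ W) (w : W) :
    Iw (SDiagramPO W) canonicalBlock (g w) = Iw (SDiagramPO W) canonicalBlock w := by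
  refine Set.Subset.antisymm ?_ (Iw_canonicalBlock_subset g w)
  simpa using Iw_canonicalBlock_subset g.symm (g w)

variable [LocallyCompactSpace W] [TotallyDisconnectedSpace W] [SecondCountableTopology W]

theorem idBlock_canonicalBlock_eq_homeoOrbit (hW : PrimitiveSpace W)
    {J : Idl (SDiagramPO W)} {w : W} (hw : w ∈ idBlock (SDiagramPO W) canonicalBlock J) :
    idBlock (SDiagramPO W) canonicalBlock J = homeoOrbit w := by
  ext x
  constructor
  · intro hx
    exact exists_homeomorph_of_Iw_eq (isTrimPartition_canonicalBlock hW)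
      (Eq.trans (hw : Iw _ _ _ = _) (hx : Iw _ _ _ = _).symm)
  · rintro ⟨g, rfl⟩
    exact (Iw_canonicalBlock_homeomorph g w).trans hw

/-- The ideals of the structure diagram correspond to the orbits. -/
noncomputable def idealEquivOrbits (hW : PrimitiveSpace W) : Idl (SDiagramPO W) ≃ Orbits W :=
  Equiv.ofBijective
    (fun J => ⟨idBlock (SDiagramPO W) canonicalBlock J,
      (idBlock_nonempty (isTrimPartition_canonicalBlock hW) J).some,
      idBlock_canonicalBlock_eq_homeoOrbit hW
        (idBlock_nonempty (isTrimPartition_canonicalBlock hW) J).some_mem⟩) <| by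
    have hX := isTrimPartition_canonicalBlock hW
    constructor
    · intro J K hJK
      obtain ⟨w, hw⟩ := idBlock_nonempty hX J
      have hblock : idBlock (SDiagramPO W) canonicalBlock J =
          idBlock (SDiagramPO W) canonicalBlock K := congrArg Subtype.val hJK
      have hw' := hw
      rw [hblock] at hw'
      exact ((mem_idBlock_iff hX).1 hw).symm.trans ((mem_idBlock_iff hX).1 hw')
    · rintro ⟨O, w, rfl⟩
      exact ⟨idealAt hX w, Subtype.ext (idBlock_canonicalBlock_eq_homeoOrbit hW rfl)⟩

theorem idealEquivOrbits_val (hW : PrimitiveSpace W) (J : Idl (SDiagramPO W)) :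
    idBlock (SDiagramPO W) canonicalBlock J = (idealEquivOrbits hW J).1 := rfl

theorem idealEquivOrbits_lt_iff (hW : PrimitiveSpace W) (J K : Idl (SDiagramPO W)) :
    (idPO (SDiagramPO W)).lt J K ↔ OrbitLt (idealEquivOrbits hW J) (idealEquivOrbits hW K) := by
  have hX := isTrimPartition_canonicalBlock hW
  unfold OrbitLt
  simp only [← idealEquivOrbits_val, mem_derivedSet_idBlock_iff hX, mem_idBlock_iff hX]
  constructor
  · intro h
    obtain ⟨w, hw⟩ := idBlock_nonempty hX J
    rw [mem_idBlock_iff hX] at hw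
    exact ⟨w, hw, hw ▸ h⟩
  · rintro ⟨w, rfl, h⟩
    exact h

/-- The orbit diagram of a primitive space as a PO system. -/
def orbitPO (hW : PrimitiveSpace W) : POSystem (Orbits W) where
  lt := OrbitLt
  lt_trans := by
    intro a b c
    obtain ⟨a, rfl⟩ := (idealEquivOrbits hW).surjective a
    obtain ⟨b, rfl⟩ := (idealEquivOrbits hW).surjective b
    obtain ⟨c, rfl⟩ := (idealEquivOrbits hW).surjective c
    simp only [← idealEquivOrbits_lt_iff]
    exact (idPO _).lt_trans
  lt_antisymm := by
    intro a b
    obtain ⟨a, rfl⟩ := (idealEquivOrbits hW).surjective a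
    obtain ⟨b, rfl⟩ := (idealEquivOrbits hW).surjective b
    simp only [← idealEquivOrbits_lt_iff]
    exact fun h h' => congrArg _ ((idPO _).lt_antisymm h h')

theorem exists_regConsolidates (hW : PrimitiveSpace W) {Q : Type*} {SQ : POSystem Q}
    {Y : Q → Set W} (hY : IsTrimPartition SQ Y) : ∃ γ : Idl SQ → Orbits W,
      RegConsolidates (idPO SQ) (orbitPO hW) (idBlock SQ Y) (fun O => O.1) γ := by
  have hX := isTrimPartition_canonicalBlock hW
  choose pt hpt using idBlock_nonempty hY
  have hsub : ∀ J, idBlock SQ Y J ⊆ homeoOrbit (pt J) := fun J x hx =>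
    exists_homeomorph_of_Iw_eq hY (Eq.trans (hpt J : Iw _ _ _ = _) (hx : Iw _ _ _ = _).symm)
  refine ⟨fun J => ⟨homeoOrbit (pt J), pt J, rfl⟩, isPPartition_idBlock hY, ?_,
    hasTrimBases_idBlock hY, ?_, hsub, ?_⟩
  · exact (isPPartition_idBlock hX).of_equiv (idealEquivOrbits hW) (idealEquivOrbits_val hW)
      (idealEquivOrbits_lt_iff hW)
  · exact (hasTrimBases_idBlock hX).of_equiv (idealEquivOrbits hW) (idealEquivOrbits_val hW)
      (idealEquivOrbits_lt_iff hW)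
  · intro O _ A hA
    obtain ⟨w, hwA, hwO⟩ := hA.exists_mem (orbitPO hW).le_rfl
    refine ⟨idealAt hY w, ⟨w, hwA, rfl⟩, Subtype.ext ?_⟩
    rw [Orbits.eq_homeoOrbit hwO]
    exact (homeoOrbit_eq_of_mem (hsub _ rfl)).symm

end OrbitDiagram

/-- For a primitive ω-Stone space `W`, the canonical partition `𝒳(W)` is a trim partition, and
its ideal completion is the orbit diagram `𝒪(W)`: the blocks are exactly the orbits, and the
order relations agree (so that `𝒪(W)` is a PO system). Moreover, `𝒪(W)` regularly consolidates
`id(𝒴)` for every trim partition `𝒴` of `W`. -/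
theorem ideal_completion_canonical_eq_orbit_diagram {W : Type u}
    [TopologicalSpace W] [SecondCountableTopology W] [LocallyCompactSpace W]
    [T2Space W] [TotallyDisconnectedSpace W] (hW : PrimitiveSpace W) :
    IsTrimPartition (SDiagramPO W) (canonicalBlock (W := W)) ∧
    ∃ SO : POSystem (Orbits W), SO.lt = OrbitLt ∧
      (∃ e : POSystem.Idl (SDiagramPO W) ≃ Orbits W,
        (∀ J, idBlock (SDiagramPO W) (canonicalBlock (W := W)) J = (e J).1) ∧
        ∀ J K, (POSystem.idPO (SDiagramPO W)).lt J K ↔ SO.lt (e J) (e K)) ∧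
      ∀ (Q : Type v) (SQ : POSystem Q) (Y : Q → Set W), IsTrimPartition SQ Y →
        ∃ γ : POSystem.Idl SQ → Orbits W,
          RegConsolidates (POSystem.idPO SQ) SO (idBlock SQ Y) (fun O => O.1) γ := by
  refine ⟨isTrimPartition_canonicalBlock hW, orbitPO hW, rfl,
    ⟨idealEquivOrbits hW, idealEquivOrbits_val hW, idealEquivOrbits_lt_iff hW⟩, ?_⟩
  intro Q SQ Y hY
  exact exists_regConsolidates hW hY
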